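/- arXiv:2107.13658 — 3 statements merged into one kernel-verified Lean document; each statement's English description precedes it below -/
import Mathlib

section
/- Every single-source outerplanar DAG admits a linear extension whose maximum twist size is at most 3. -/
/-- The vertex set of a directed edge set. -/
def verts (E : Finset (ℕ × ℕ)) : Finset ℕ := E.image Prod.fst ∪ E.image Prod.snd

/-- Two directed edges cross with respect to a vertex order `f`
(the order places vertex `v` at position `f v`). -/
def Crosses (f : ℕ → ℕ) (e e' : ℕ × ℕ) : Prop :=
  (f e.1 < f e'.1 ∧ f e'.1 < f e.2 ∧ f e.2 < f e'.2) ∨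
  (f e'.1 < f e.1 ∧ f e.1 < f e'.2 ∧ f e'.2 < f e.2)

/-- `f` is (an injective position function representing) a linear extension of `E`. -/
def LinExt (E : Finset (ℕ × ℕ)) (f : ℕ → ℕ) : Prop :=
  Function.Injective f ∧ ∀ e ∈ E, f e.1 < f e.2

/-- The edges `(s i, t i)` form a `k`-twist under `f`:
`s 0 < … < s (k-1) < t 0 < … < t (k-1)`. -/
def IsTwist (E : Finset (ℕ × ℕ)) (f : ℕ → ℕ) (k : ℕ) (s t : Fin k → ℕ) : Prop :=
  (∀ i, (s i, t i) ∈ E) ∧ StrictMono (f ∘ s) ∧ StrictMono (f ∘ t) ∧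
    ∀ i j, f (s i) < f (t j)

/-- The maximum twist size of `E` under `f` is at most `k`. -/
def TwistLE (E : Finset (ℕ × ℕ)) (f : ℕ → ℕ) (k : ℕ) : Prop :=
  ∀ m, ∀ s t : Fin m → ℕ, IsTwist E f m s t → m ≤ k

/-- `c` assigns edges to stacks: edges in the same stack never cross. -/
def ValidStacks (E : Finset (ℕ × ℕ)) (f : ℕ → ℕ) (c : ℕ × ℕ → ℕ) : Prop :=
  ∀ e ∈ E, ∀ e' ∈ E, c e = c e' → ¬ Crosses f e e'

/-- `E` admits a `k`-stack layout: a linear extension together with a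
partition of the edges into `k` stacks of pairwise non-crossing edges. -/
def HasStackLayout (E : Finset (ℕ × ℕ)) (k : ℕ) : Prop :=
  ∃ f c, LinExt E f ∧ (∀ e ∈ E, c e < k) ∧ ValidStacks E f c

/-- Construction of maximal single-source outerplanar DAGs from a base edge by
stellating a not-yet-stellated outerface edge `(u,v)` with a fresh vertex `x`,
adding either `(u,x),(x,v)` (transitive) or `(u,x),(v,x)` (monotone sink).
`SSBuild E A` holds when `E` is constructible with `A` the set of outerface
edges that have not yet been stellated. -/
inductive SSBuild : Finset (ℕ × ℕ) → Finset (ℕ × ℕ) → Prop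
  | base (s t : ℕ) (h : s ≠ t) : SSBuild {(s, t)} {(s, t)}
  | transitive (E A : Finset (ℕ × ℕ)) (u v x : ℕ) (hE : SSBuild E A)
      (hA : (u, v) ∈ A) (hx : x ∉ verts E) :
      SSBuild (insert (u, x) (insert (x, v) E))
        (insert (u, x) (insert (x, v) (A.erase (u, v))))
  | monoSink (E A : Finset (ℕ × ℕ)) (u v x : ℕ) (hE : SSBuild E A)
      (hA : (u, v) ∈ A) (hx : x ∉ verts E) :
      SSBuild (insert (u, x) (insert (v, x) E))
        (insert (u, x) (insert (v, x) (A.erase (u, v))))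

/-- A single-source outerplanar DAG. -/
def IsSingleSourceODAG (E : Finset (ℕ × ℕ)) : Prop := ∃ A, SSBuild E A

/-- A layout `f` of the edges `E` built so far, with the outerface edges `P` still to be
stellated, in a sweep that always stellates an edge of `P` whose source is leftmost. -/
structure SweepInv (E P : Set (ℕ × ℕ)) (f : ℕ → ℕ) : Prop where
  subset : P ⊆ E
  inj : ∀ a b, (∃ e ∈ E, a = e.1 ∨ a = e.2) → (∃ e ∈ E, b = e.1 ∨ b = e.2) → f a = f b → a = b
  mono : ∀ a b, (a, b) ∈ E → f a < f b
  /-- Edges that are no longer pending start weakly left of all pending edges. -/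
  done : ∀ a b, (a, b) ∈ E → (a, b) ∈ P ∨ ∀ c d, (c, d) ∈ P → f a ≤ f c
  /-- Of two crossing pending edges, one starts at the leftmost pending source. -/
  cross : ∀ a b c d, (a, b) ∈ P → (c, d) ∈ P → f a < f c → f c < f b → f b < f d →
    ∀ p q, (p, q) ∈ P → f a ≤ f p
  /-- If a pending edge `(a, b)` is crossed from the right by a pending edge, then `a` is the
  leftmost in-neighbour of `b`. -/
  leftmost : ∀ a b c d s, (a, b) ∈ P → (c, d) ∈ P → f a < f c → f c < f b → f b < f d →
    (s, b) ∈ E → f a ≤ f s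
  /-- The edges that enter the span of a pending edge from the left have no 3-twist. -/
  enter : ∀ c y, (c, y) ∈ P → ∀ s₁ t₁ s₂ t₂ s₃ t₃,
    (s₁, t₁) ∈ E → (s₂, t₂) ∈ E → (s₃, t₃) ∈ E →
    f s₁ < f s₂ → f s₂ < f s₃ → f s₃ < f c → f c < f t₁ → f t₁ < f t₂ → f t₂ < f t₃ →
    f t₃ ≤ f y → False
  twist : ∀ s₁ t₁ s₂ t₂ s₃ t₃ s₄ t₄,
    (s₁, t₁) ∈ E → (s₂, t₂) ∈ E → (s₃, t₃) ∈ E → (s₄, t₄) ∈ E →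
    f s₁ < f s₂ → f s₂ < f s₃ → f s₃ < f s₄ → f s₄ < f t₁ → f t₁ < f t₂ → f t₂ < f t₃ →
    f t₃ < f t₄ → False

/-- Dropping a pending edge with leftmost source. -/
theorem SweepInv.drop {E P : Set (ℕ × ℕ)} {f : ℕ → ℕ} {u v : ℕ}
    (h : SweepInv E (insert (u, v) P) f) (hmin : ∀ c d, (c, d) ∈ P → f u ≤ f c) :
    SweepInv E P f where
  subset := fun e he => h.subset (Or.inr he)
  inj := h.inj
  mono := h.mono
  done := fun a b hab => by
    rcases h.done a b hab with h1 | h1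
    · rcases h1 with h1 | h1
      · obtain ⟨rfl, rfl⟩ := Prod.mk.inj h1
        exact Or.inr hmin
      · exact Or.inl h1
    · exact Or.inr fun c d hc => h1 c d (Or.inr hc)
  cross := fun a b c d hab hcd h1 h2 h3 p q hp =>
    h.cross a b c d (Or.inr hab) (Or.inr hcd) h1 h2 h3 p q (Or.inr hp)
  leftmost := fun a b c d s hab hcd => h.leftmost a b c d s (Or.inr hab) (Or.inr hcd)
  enter := fun c y hc => h.enter c y (Or.inr hc)
  twist := h.twist

/-- Stellating a pending edge `(u, v)` with leftmost source by a fresh vertex `x` that is placed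
next to `v`; here `(p, q)` is the new edge between `x` and `v`. -/
theorem SweepInv.stellate {E P : Set (ℕ × ℕ)} {f g : ℕ → ℕ} {u v x p q : ℕ}
    (h : SweepInv E (insert (u, v) P) f) (hmin : ∀ c d, (c, d) ∈ P → f u ≤ f c)
    (hdeg : ∀ s c, (s, v) ∈ P → (c, v) ∈ P → s = c)
    (hx : ∀ e ∈ E, x ≠ e.1 ∧ x ≠ e.2)
    (hg : ∀ a, a ≠ x → g a = 2 * f a)
    (hpq : (p = x ∧ q = v ∧ g x + 1 = 2 * f v) ∨ (p = v ∧ q = x ∧ g x = 2 * f v + 1)) :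
    SweepInv (insert (u, x) (insert (p, q) E)) (insert (u, x) (insert (p, q) P)) g := by
  have huvE : (u, v) ∈ E := h.subset (Or.inl rfl)
  have huv := h.mono u v huvE
  have hux : u ≠ x := fun e => (hx _ huvE).1 e.symm
  have hvx : v ≠ x := fun e => (hx _ huvE).2 e.symm
  have hgu := hg u hux
  have hgv := hg v hvx
  have hE : ∀ a b, (a, b) ∈ E → g a = 2 * f a ∧ g b = 2 * f b ∧ a ≠ x ∧ b ≠ x := by
    intro a b hab
    have := hx _ hab
    exact ⟨hg a (Ne.symm this.1), hg b (Ne.symm this.2), Ne.symm this.1, Ne.symm this.2⟩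
  have hPE : ∀ a b, (a, b) ∈ P → (a, b) ∈ E := fun a b hab => h.subset (Or.inr hab)
  have hE' : ∀ a b, (a, b) ∈ insert (u, x) (insert (p, q) E) →
      (a = u ∧ b = x) ∨ (a = p ∧ b = q) ∨ (a, b) ∈ E := by
    intro a b hab
    simpa [Set.mem_insert_iff] using hab
  have hP' : ∀ a b, (a, b) ∈ insert (u, x) (insert (p, q) P) →
      (a = u ∧ b = x) ∨ (a = p ∧ b = q) ∨ (a, b) ∈ P := by
    intro a b hab
    simpa [Set.mem_insert_iff] using hab
  have hinjv : ∀ a b, (a, b) ∈ E → f b = f v → b = v := fun a b hab e =>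
    h.inj b v ⟨_, hab, Or.inr rfl⟩ ⟨_, huvE, Or.inr rfl⟩ e
  -- an old edge that starts right of `u` is pending
  have hpend : ∀ a b, (a, b) ∈ E → f u < f a → (a, b) ∈ P := by
    intro a b hab hlt
    rcases h.done a b hab with h1 | h1
    · rcases h1 with h1 | h1
      · obtain ⟨rfl, rfl⟩ := Prod.mk.inj h1
        omega
      · exact h1
    · have := h1 u v (Or.inl rfl)
      omega
  have hnocross : ∀ a b c d, (a, b) ∈ E → (c, d) ∈ E → f u < f a → f a < f c → f c < f b →
      f b < f d → False := by
    intro a b c d hab hcd h1 h2 h3 h4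
    have := h.cross a b c d (Or.inr (hpend a b hab h1)) (Or.inr (hpend c d hcd (by omega)))
      h2 h3 h4 u v (Or.inl rfl)
    omega
  -- the short new edge crosses nothing
  have hshort : g p < g q ∧ g q ≤ g p + 1 := by
    rcases hpq with ⟨rfl, rfl, h1⟩ | ⟨rfl, rfl, h1⟩ <;> omega
  have hup : g u < g p := by
    rcases hpq with ⟨rfl, rfl, h1⟩ | ⟨rfl, rfl, h1⟩ <;> omega
  have hmin' : ∀ c d, (c, d) ∈ insert (u, x) (insert (p, q) P) → g u ≤ g c := by
    intro c d hcd
    rcases hP' c d hcd with ⟨rfl, rfl⟩ | ⟨rfl, rfl⟩ | hcd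
    · exact le_rfl
    · exact hup.le
    · have := hmin c d hcd
      have := hE c d (hPE c d hcd)
      omega
  have hxin : ∀ s, (s, x) ∈ insert (u, x) (insert (p, q) E) → g u ≤ g s := by
    intro s hs
    rcases hE' s x hs with ⟨rfl, -⟩ | ⟨rfl, -⟩ | hs
    · exact le_rfl
    · exact hup.le
    · exact absurd rfl (hE _ _ hs).2.2.2
  -- no 3-twist of edges enters the span of an old pending edge
  have henter : ∀ c y, (c, y) ∈ insert (u, v) P → ∀ s₁ t₁ s₂ t₂ s₃ t₃,
      (s₁, t₁) ∈ insert (u, x) (insert (p, q) E) → (s₂, t₂) ∈ insert (u, x) (insert (p, q) E) →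
      (s₃, t₃) ∈ insert (u, x) (insert (p, q) E) →
      g s₁ < g s₂ → g s₂ < g s₃ → g s₃ < g c → g c < g t₁ → g t₁ < g t₂ → g t₂ < g t₃ →
      g t₃ ≤ g y → False := by
    intro c y hcy s₁ t₁ s₂ t₂ s₃ t₃ e₁ e₂ e₃ a1 a2 a3 a4 a5 a6 a7
    obtain ⟨gc, gy, cx, yx⟩ := hE c y (h.subset hcy)
    have key := h.enter c y hcy
    rcases hE' _ _ e₁ with ⟨rfl, rfl⟩ | ⟨rfl, rfl⟩ | o₁
    · rcases hE' _ _ e₂ with ⟨rfl, rfl⟩ | ⟨rfl, rfl⟩ | o₂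
      · omega
      · omega
      · rcases hE' _ _ e₃ with ⟨rfl, rfl⟩ | ⟨rfl, rfl⟩ | o₃
        · omega
        · omega
        · have := hE _ _ o₂
          have := hE _ _ o₃
          exact hnocross s₂ t₂ s₃ t₃ o₂ o₃ (by omega) (by omega) (by omega) (by omega)
    · omega
    · have := hE _ _ o₁
      rcases hE' _ _ e₂ with ⟨rfl, rfl⟩ | ⟨rfl, rfl⟩ | o₂
      · rcases hE' _ _ e₃ with ⟨rfl, rfl⟩ | ⟨rfl, rfl⟩ | o₃
        · omega
        · omega
        · have := hE _ _ o₃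
          have hcyP : (c, y) ∈ P := hpend c y (h.subset hcy) (by omega)
          have hs₃ : (s₃, t₃) ∈ P := hpend _ _ o₃ (by omega)
          rcases hpq with ⟨rfl, rfl, h1⟩ | ⟨rfl, rfl, h1⟩
          · by_cases ht : f t₃ = f q
            · obtain rfl := hinjv _ _ o₃ ht
              by_cases hy : f y = f t₃
              · obtain rfl := hinjv _ _ (h.subset hcy) hy
                obtain rfl := hdeg _ _ hcyP hs₃
                omega
              · exact hnocross s₃ t₃ c y o₃ (h.subset hcy) (by omega) (by omega) (by omega)
                  (by omega)
            · exact key s₁ t₁ s₂ q s₃ t₃ o₁ huvE o₃ (by omega) (by omega) (by omega) (by omega)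
                (by omega) (by omega) (by omega)
          · by_cases ht : f t₁ = f p
            · obtain rfl := hinjv _ _ o₁ ht
              have := h.leftmost s₂ t₁ c y s₁ (Or.inl rfl) hcy (by omega) (by omega) (by omega) o₁
              omega
            · exact key s₁ t₁ s₂ p s₃ t₃ o₁ huvE o₃ (by omega) (by omega) (by omega) (by omega)
                (by omega) (by omega) (by omega)
      · omega
      · have := hE _ _ o₂
        rcases hE' _ _ e₃ with ⟨rfl, rfl⟩ | ⟨rfl, rfl⟩ | o₃
        · rcases hpq with ⟨rfl, rfl, h1⟩ | ⟨rfl, rfl, h1⟩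
          · exact key s₁ t₁ s₂ t₂ s₃ q o₁ o₂ huvE (by omega) (by omega) (by omega) (by omega)
              (by omega) (by omega) (by omega)
          · by_cases ht : f t₂ = f p
            · obtain rfl := hinjv _ _ o₂ ht
              have := h.leftmost s₃ t₂ c y s₂ (Or.inl rfl) hcy (by omega) (by omega) (by omega) o₂
              omega
            · exact key s₁ t₁ s₂ t₂ s₃ p o₁ o₂ huvE (by omega) (by omega) (by omega) (by omega)
                (by omega) (by omega) (by omega)
        · omega
        · have := hE _ _ o₃
          exact key s₁ t₁ s₂ t₂ s₃ t₃ o₁ o₂ o₃ (by omega) (by omega) (by omega) (by omega)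
            (by omega) (by omega) (by omega)
  have henter' : ∀ c y, (c, y) ∈ insert (u, x) (insert (p, q) P) → ∀ s₁ t₁ s₂ t₂ s₃ t₃,
      (s₁, t₁) ∈ insert (u, x) (insert (p, q) E) → (s₂, t₂) ∈ insert (u, x) (insert (p, q) E) →
      (s₃, t₃) ∈ insert (u, x) (insert (p, q) E) →
      g s₁ < g s₂ → g s₂ < g s₃ → g s₃ < g c → g c < g t₁ → g t₁ < g t₂ → g t₂ < g t₃ →
      g t₃ ≤ g y → False := by
    intro c y hcy s₁ t₁ s₂ t₂ s₃ t₃ e₁ e₂ e₃ a1 a2 a3 a4 a5 a6 a7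
    rcases hP' c y hcy with ⟨rfl, rfl⟩ | ⟨rfl, rfl⟩ | hcyP
    · by_cases ht : g t₃ ≤ g v
      · exact henter c v (Or.inl rfl) s₁ t₁ s₂ t₂ s₃ t₃ e₁ e₂ e₃ a1 a2 a3 a4 a5 a6 ht
      · rcases hE' _ _ e₃ with ⟨rfl, rfl⟩ | ⟨rfl, rfl⟩ | e₃
        · omega
        · omega
        · have := hE _ _ e₃
          rcases hpq with ⟨rfl, rfl, h1⟩ | ⟨rfl, rfl, h1⟩ <;> omega
    · omega
    · exact henter c y (Or.inr hcyP) s₁ t₁ s₂ t₂ s₃ t₃ e₁ e₂ e₃ a1 a2 a3 a4 a5 a6 a7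
  refine ⟨?_, ?_, ?_, ?_, ?_, ?_, henter', ?_⟩
  · exact Set.insert_subset_insert (Set.insert_subset_insert fun e he => h.subset (Or.inr he))
  · have hvert : ∀ a, (∃ e ∈ insert (u, x) (insert (p, q) E), a = e.1 ∨ a = e.2) →
        a = x ∨ (a ≠ x ∧ ∃ e ∈ E, a = e.1 ∨ a = e.2) := by
      rintro a ⟨⟨c, d⟩, hcd, ha⟩
      by_cases hax : a = x
      · exact Or.inl hax
      · refine Or.inr ⟨hax, ?_⟩
        rcases hE' c d hcd with ⟨rfl, rfl⟩ | ⟨rfl, rfl⟩ | hcd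
        · exact ⟨_, huvE, Or.inl (ha.resolve_right hax)⟩
        · refine ⟨_, huvE, Or.inr ?_⟩
          rcases hpq with ⟨rfl, rfl, -⟩ | ⟨rfl, rfl, -⟩
          · exact ha.resolve_left hax
          · exact ha.resolve_right hax
        · exact ⟨_, hcd, ha⟩
    intro a b ha hb hab
    rcases hvert a ha with rfl | ⟨hax, ha⟩ <;> rcases hvert b hb with rfl | ⟨hbx, hb⟩
    · rfl
    · have := hg b hbx
      omega
    · have := hg a hax
      omega
    · have := hg a hax
      have := hg b hbx
      exact h.inj a b ha hb (by omega)
  · intro a b hab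
    rcases hE' a b hab with ⟨rfl, rfl⟩ | ⟨rfl, rfl⟩ | hab
    · omega
    · omega
    · have := hE a b hab
      have := h.mono a b hab
      omega
  · intro a b hab
    rcases hE' a b hab with ⟨rfl, rfl⟩ | ⟨rfl, rfl⟩ | hab
    · exact Or.inr hmin'
    · exact Or.inl (Or.inr (Or.inl rfl))
    · by_cases hlt : f u < f a
      · exact Or.inl (Or.inr (Or.inr (hpend a b hab hlt)))
      · refine Or.inr fun c d hcd => ?_
        have := hmin' c d hcd
        have := hE a b hab
        omega
  · intro a b c d hab hcd h1 h2 h3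
    rcases hP' a b hab with ⟨rfl, rfl⟩ | ⟨rfl, rfl⟩ | kab
    · exact hmin'
    · omega
    · have hab' := hE a b (hPE a b kab)
      rcases hP' c d hcd with ⟨rfl, rfl⟩ | ⟨rfl, rfl⟩ | kcd
      · have := hmin a b kab
        omega
      · omega
      · have hcd' := hE c d (hPE c d kcd)
        have := h.cross a b c d (Or.inr kab) (Or.inr kcd) (by omega) (by omega) (by omega) u v
          (Or.inl rfl)
        intro r s hrs
        have := hmin' r s hrs
        omega
  · intro a b c d s hab hcd h1 h2 h3 hs
    rcases hP' a b hab with ⟨rfl, rfl⟩ | ⟨rfl, rfl⟩ | kab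
    · exact hxin s hs
    · omega
    · have hab' := hE a b (hPE a b kab)
      rcases hP' c d hcd with ⟨rfl, rfl⟩ | ⟨rfl, rfl⟩ | kcd
      · have := hmin a b kab
        omega
      · omega
      · have hcd' := hE c d (hPE c d kcd)
        rcases hE' s b hs with ⟨rfl, rfl⟩ | ⟨rfl, rfl⟩ | hs
        · exact absurd rfl hab'.2.2.2
        · omega
        · have := h.leftmost a b c d s (Or.inr kab) (Or.inr kcd) (by omega) (by omega) (by omega) hs
          have := hE s b hs
          omega
  · intro s₁ t₁ s₂ t₂ s₃ t₃ s₄ t₄ e₁ e₂ e₃ e₄ a1 a2 a3 a4 a5 a6 a7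
    by_cases h4 : (s₄, t₄) ∈ insert (u, x) (insert (p, q) P)
    · exact henter' s₄ t₄ h4 s₁ t₁ s₂ t₂ s₃ t₃ e₁ e₂ e₃ a1 a2 a3 a4 a5 a6 a7.le
    · have hs₄ : (s₄, t₄) ∈ E ∧ f s₄ ≤ f u := by
        rcases e₄ with e₄ | e₄ | e₄
        · exact absurd (Or.inl e₄) h4
        · exact absurd (Or.inr (Or.inl e₄)) h4
        · refine ⟨e₄, ?_⟩
          by_contra hlt
          exact h4 (Or.inr (Or.inr (hpend _ _ e₄ (by omega))))
      have := hE _ _ hs₄.1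
      have hold : ∀ a b, (a, b) ∈ insert (u, x) (insert (p, q) E) → g a < g s₄ → (a, b) ∈ E := by
        intro a b hab hlt
        rcases hE' a b hab with ⟨rfl, rfl⟩ | ⟨rfl, rfl⟩ | hab
        · omega
        · omega
        · exact hab
      have e₁ := hold _ _ e₁ (by omega)
      have e₂ := hold _ _ e₂ (by omega)
      have e₃ := hold _ _ e₃ (by omega)
      have := hE _ _ e₁
      have := hE _ _ e₂
      have := hE _ _ e₃
      exact h.twist s₁ t₁ s₂ t₂ s₃ t₃ s₄ t₄ e₁ e₂ e₃ hs₄.1 (by omega) (by omega) (by omega)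
        (by omega) (by omega) (by omega) (by omega)

/-- The tree of stellations performed above an edge: `node k x l r` stellates the edge `(u, v)`
with `x`, as a monotone sink if `k` holds and transitively otherwise, where `l` stellates `(u, x)`
and `r` stellates the new edge between `v` and `x`. -/
inductive StellationTree : Type
  | leaf : StellationTree
  | node (k : Bool) (x : ℕ) (l r : StellationTree) : StellationTree

namespace StellationTree

/-- The edge between the head `v` of a stellated edge and the new vertex `x`. -/
def short (k : Bool) (v x : ℕ) : ℕ × ℕ := if k then (v, x) else (x, v)

/-- The edges added above the edge `e`. -/
def edges : StellationTree → ℕ × ℕ → Set (ℕ × ℕ)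
  | leaf, _ => ∅
  | node k x l r, e =>
    insert (e.1, x) (insert (short k e.2 x) (l.edges (e.1, x) ∪ r.edges (short k e.2 x)))

/-- The edges above `e` that are not stellated. -/
def leaves : StellationTree → ℕ × ℕ → Set (ℕ × ℕ)
  | leaf, e => {e}
  | node k x l r, e => l.leaves (e.1, x) ∪ r.leaves (short k e.2 x)

/-- The vertices added. -/
def vertices : StellationTree → Multiset ℕ
  | leaf => 0
  | node _ x l r => x ::ₘ (l.vertices + r.vertices)

/-- The number of nodes, leaves included. -/
def size : StellationTree → ℕ
  | leaf => 1
  | node _ _ l r => l.size + r.size + 1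

theorem exists_edge_of_mem_vertices {a : ℕ} (T : StellationTree) :
    ∀ e, a ∈ T.vertices → ∃ e' ∈ T.edges e, a = e'.1 ∨ a = e'.2 := by
  induction T with
  | leaf => intro e h; simp [vertices] at h
  | node k x l r ihl ihr =>
    intro e h
    simp only [vertices, Multiset.mem_cons, Multiset.mem_add] at h
    rcases h with rfl | h | h
    · exact ⟨_, Or.inl rfl, Or.inr rfl⟩
    · obtain ⟨e', he, ha⟩ := ihl (e.1, x) h
      exact ⟨e', Or.inr (Or.inr (Or.inl he)), ha⟩
    · obtain ⟨e', he, ha⟩ := ihr (short k e.2 x) h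
      exact ⟨e', Or.inr (Or.inr (Or.inr he)), ha⟩

/-- Stellating a leaf edge `p` of a tree. -/
theorem exists_stellate (k : Bool) (x : ℕ) (p : ℕ × ℕ) (T : StellationTree) :
    ∀ e, p ∈ T.leaves e → ∃ T' : StellationTree,
      T'.vertices = x ::ₘ T.vertices ∧
      T'.edges e = insert (p.1, x) (insert (short k p.2 x) (T.edges e)) ∧
      ∀ a, a = (p.1, x) ∨ a = short k p.2 x ∨ (a ∈ T.leaves e ∧ a ≠ p) → a ∈ T'.leaves e := by
  induction T with
  | leaf =>
    intro e h
    obtain rfl : p = e := h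
    refine ⟨node k x leaf leaf, rfl, by simp [edges], ?_⟩
    rintro a (rfl | rfl | ⟨h1, h2⟩)
    · exact Or.inl rfl
    · exact Or.inr rfl
    · exact absurd h1 h2
  | node k' y l r ihl ihr =>
    intro e h
    rcases h with h | h
    · obtain ⟨T', hv, he, hl⟩ := ihl _ h
      refine ⟨node k' y T' r, ?_, ?_, ?_⟩
      · simp only [vertices, hv, Multiset.cons_add]
        exact Multiset.cons_swap _ _ _
      · simp only [edges, he]
        ext a
        simp only [Set.mem_insert_iff, Set.mem_union]
        tauto
      · intro a ha
        rcases ha with ha | ha | ⟨ha | ha, hp⟩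
        · exact Or.inl (hl a (Or.inl ha))
        · exact Or.inl (hl a (Or.inr (Or.inl ha)))
        · exact Or.inl (hl a (Or.inr (Or.inr ⟨ha, hp⟩)))
        · exact Or.inr ha
    · obtain ⟨T', hv, he, hl⟩ := ihr _ h
      refine ⟨node k' y l T', ?_, ?_, ?_⟩
      · simp only [vertices, hv, Multiset.add_cons]
        exact Multiset.cons_swap _ _ _
      · simp only [edges, he]
        ext a
        simp only [Set.mem_insert_iff, Set.mem_union]
        tauto
      · intro a ha
        rcases ha with ha | ha | ⟨ha | ha, hp⟩
        · exact Or.inr (hl a (Or.inl ha))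
        · exact Or.inr (hl a (Or.inr (Or.inl ha)))
        · exact Or.inl ha
        · exact Or.inr (hl a (Or.inr (Or.inr ⟨ha, hp⟩)))

end StellationTree

theorem mem_verts_iff {E : Finset (ℕ × ℕ)} {a : ℕ} :
    a ∈ verts E ↔ ∃ e ∈ E, a = e.1 ∨ a = e.2 := by
  simp only [verts, Finset.mem_union, Finset.mem_image]
  constructor
  · rintro (⟨e, he, rfl⟩ | ⟨e, he, rfl⟩)
    · exact ⟨e, he, Or.inl rfl⟩
    · exact ⟨e, he, Or.inr rfl⟩
  · rintro ⟨e, he, rfl | rfl⟩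
    · exact Or.inl ⟨e, he, rfl⟩
    · exact Or.inr ⟨e, he, rfl⟩

/-- `E` arises from a base edge by performing the stellations of a tree, with `A` among the
edges that are not stellated. -/
def HasStellationTree (E A : Finset (ℕ × ℕ)) : Prop :=
  ∃ (b : ℕ × ℕ) (T : StellationTree), b.1 ≠ b.2 ∧ (b.1 ::ₘ b.2 ::ₘ T.vertices).Nodup ∧
    (∀ e, e ∈ E ↔ e = b ∨ e ∈ T.edges b) ∧ ∀ e ∈ A, e ∈ T.leaves b

theorem HasStellationTree.stellate {E A : Finset (ℕ × ℕ)} (h : HasStellationTree E A) (k : Bool)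
    {u v x : ℕ} (hA : (u, v) ∈ A) (hx : x ∉ verts E) :
    HasStellationTree (insert (u, x) (insert (StellationTree.short k v x) E))
      (insert (u, x) (insert (StellationTree.short k v x) (A.erase (u, v)))) := by
  obtain ⟨b, T, hb, hnd, hE, hl⟩ := h
  obtain ⟨T', hv, he, hl'⟩ := T.exists_stellate k x (u, v) b (hl _ hA)
  rw [mem_verts_iff] at hx
  refine ⟨b, T', hb, ?_, ?_, ?_⟩
  · have hx1 : x ≠ b.1 := fun e => hx ⟨b, (hE b).2 (Or.inl rfl), Or.inl e⟩
    have hx2 : x ≠ b.2 := fun e => hx ⟨b, (hE b).2 (Or.inl rfl), Or.inr e⟩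
    have hx3 : x ∉ T.vertices := fun hm => by
      obtain ⟨e, he, hxe⟩ := T.exists_edge_of_mem_vertices b hm
      exact hx ⟨e, (hE e).2 (Or.inr he), hxe⟩
    simp only [hv, Multiset.nodup_cons, Multiset.mem_cons, not_or] at hnd ⊢
    exact ⟨⟨hnd.1.1, hx1.symm, hnd.1.2⟩, ⟨hx2.symm, hnd.2.1⟩, hx3, hnd.2.2⟩
  · intro e
    rw [he]
    simp only [Finset.mem_insert, Set.mem_insert_iff, hE]
    tauto
  · intro e hm
    simp only [Finset.mem_insert, Finset.mem_erase] at hm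
    apply hl'
    rcases hm with hm | hm | ⟨h1, h2⟩
    · exact Or.inl hm
    · exact Or.inr (Or.inl hm)
    · exact Or.inr (Or.inr ⟨hl e h2, h1⟩)

theorem SSBuild.hasStellationTree {E A : Finset (ℕ × ℕ)} (h : SSBuild E A) :
    HasStellationTree E A := by
  induction h with
  | base s t h =>
    exact ⟨(s, t), .leaf, h, by simp [StellationTree.vertices, h],
      by simp [StellationTree.edges], by simp [StellationTree.leaves]⟩
  | transitive E A u v x _ hA hx ih => exact ih.stellate false hA hx
  | monoSink E A u v x _ hA hx ih => exact ih.stellate true hA hx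

/-- The sweep: a layout with pending trees of stellations extends to a layout of all edges. -/
theorem exists_layout_of_pending (n : ℕ) :
    ∀ (L : Multiset ((ℕ × ℕ) × StellationTree)) (E : Set (ℕ × ℕ)) (f : ℕ → ℕ),
      (L.map fun p => p.2.size).sum ≤ n →
      (L.bind fun p => p.2.vertices).Nodup →
      (∀ e ∈ E, e.1 ∉ (L.bind fun p => p.2.vertices) ∧ e.2 ∉ (L.bind fun p => p.2.vertices)) →
      (∀ v, L.countP (fun p => p.1.2 = v) ≤ 2) →
      SweepInv E {e | ∃ T, (e, T) ∈ L} f →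
      ∃ g, SweepInv (E ∪ {e | ∃ p ∈ L, e ∈ p.2.edges p.1}) ∅ g := by
  induction n with
  | zero =>
    intro L E f hsize _ _ _ hinv
    have hL : L = 0 := by
      by_contra hne
      obtain ⟨p, hp⟩ := Multiset.exists_mem_of_ne_zero hne
      obtain ⟨L', rfl⟩ := Multiset.exists_cons_of_mem hp
      have : 0 < p.2.size := by cases p.2 <;> simp [StellationTree.size]
      simp at hsize
      omega
    subst hL
    exact ⟨f, by simpa using hinv⟩
  | succ n ih =>
    intro L E f hsize hnd hfresh hdeg hinv
    by_cases hne : L = 0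
    · subst hne
      exact ⟨f, by simpa using hinv⟩
    obtain ⟨p₀, hp₀⟩ := Multiset.exists_mem_of_ne_zero hne
    obtain ⟨⟨⟨u, v⟩, T⟩, hp, hpmin⟩ : ∃ p ∈ L, ∀ r ∈ L, f p.1.1 ≤ f r.1.1 := by
      obtain ⟨a, ha, hmin⟩ := Finset.exists_min_image (L.map fun p => p.1.1).toFinset f
        ⟨p₀.1.1, Multiset.mem_toFinset.2 (Multiset.mem_map_of_mem _ hp₀)⟩
      obtain ⟨p, hp, rfl⟩ := Multiset.mem_map.1 (Multiset.mem_toFinset.1 ha)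
      exact ⟨p, hp, fun r hr => hmin r.1.1
        (Multiset.mem_toFinset.2 (Multiset.mem_map_of_mem _ hr))⟩
    obtain ⟨L', rfl⟩ := Multiset.exists_cons_of_mem hp
    have hP : {e | ∃ T', (e, T') ∈ ((u, v), T) ::ₘ L'} =
        insert (u, v) {e | ∃ T', (e, T') ∈ L'} := by
      ext e
      simp only [Set.mem_ofPred_eq, Multiset.mem_cons, Set.mem_insert_iff, Prod.mk.injEq]
      constructor
      · rintro ⟨T', ⟨h1, -⟩ | h1⟩
        · exact Or.inl h1
        · exact Or.inr ⟨T', h1⟩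
      · rintro (h1 | ⟨T', h1⟩)
        · exact ⟨T, Or.inl ⟨h1, rfl⟩⟩
        · exact ⟨T', Or.inr h1⟩
    rw [hP] at hinv
    have hmin : ∀ c d, (c, d) ∈ {e | ∃ T', (e, T') ∈ L'} → f u ≤ f c := by
      rintro c d ⟨T', h1⟩
      exact hpmin _ (Multiset.mem_cons_of_mem h1)
    cases T with
    | leaf =>
      obtain ⟨g, hg⟩ := ih L' E f (by simp [StellationTree.size] at hsize; omega)
        (by simpa [StellationTree.vertices] using hnd)
        (by simpa [StellationTree.vertices] using hfresh)
        (fun w => (Multiset.countP_le_of_le _ (Multiset.le_cons_self _ _)).trans (hdeg w))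
        (hinv.drop hmin)
      refine ⟨g, ?_⟩
      simpa [StellationTree.edges] using hg
    | node k x l r =>
      simp only [Multiset.cons_bind, StellationTree.vertices, Multiset.cons_add,
        Multiset.nodup_cons, add_assoc] at hnd hfresh
      obtain ⟨hxnot, hnd⟩ := hnd
      have huvE : (u, v) ∈ E := hinv.subset (Or.inl rfl)
      have hxE : ∀ e ∈ E, x ≠ e.1 ∧ x ≠ e.2 := fun e he =>
        ⟨fun h => (hfresh e he).1 (h ▸ Multiset.mem_cons_self _ _),
          fun h => (hfresh e he).2 (h ▸ Multiset.mem_cons_self _ _)⟩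
      have huv := hinv.mono u v huvE
      have hstep := hinv.stellate (x := x) (p := (StellationTree.short k v x).1)
        (q := (StellationTree.short k v x).2)
        (g := fun a => if a = x then (if k then 2 * f v + 1 else 2 * f v - 1) else 2 * f a)
        hmin (by
          rintro s c ⟨T₁, h1⟩ ⟨T₂, h2⟩
          by_contra hsc
          obtain ⟨M, rfl⟩ := Multiset.exists_cons_of_mem h1
          have h2 : ((c, v), T₂) ∈ M := by
            rcases Multiset.mem_cons.1 h2 with h2 | h2
            · simp only [Prod.mk.injEq] at h2
              exact absurd h2.1.1.symm hsc
            · exact h2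
          obtain ⟨M, rfl⟩ := Multiset.exists_cons_of_mem h2
          have := hdeg v
          simp at this) hxE (fun a ha => by simp [ha])
        (by
          cases k
          · refine Or.inl ⟨rfl, rfl, ?_⟩
            simp
            omega
          · exact Or.inr ⟨rfl, rfl, by simp⟩)
      have hvx : v ≠ x := fun h => (hxE _ huvE).2 h.symm
      have hcount : L'.countP (fun p => p.1.2 = x) = 0 := by
        rw [Multiset.countP_eq_zero]
        rintro ⟨e, T'⟩ hm h
        exact (hxE e (hinv.subset (Or.inr ⟨T', hm⟩))).2 h.symm
      obtain ⟨g, hg⟩ := ih (((u, x), l) ::ₘ (StellationTree.short k v x, r) ::ₘ L')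
        (insert (u, x) (insert (StellationTree.short k v x) E)) _
        (by simp [StellationTree.size] at hsize ⊢; omega)
        (by simpa using hnd)
        (by
          have hE : ∀ e ∈ E, e.1 ∉ l.vertices + (r.vertices + L'.bind fun p => p.2.vertices) ∧
              e.2 ∉ l.vertices + (r.vertices + L'.bind fun p => p.2.vertices) := fun e he =>
            ⟨fun h => (hfresh e he).1 (Multiset.mem_cons_of_mem h),
              fun h => (hfresh e he).2 (Multiset.mem_cons_of_mem h)⟩
          have huv' := hE _ huvE
          simp only [Multiset.cons_bind]
          rintro e (rfl | rfl | he)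
          · exact ⟨huv'.1, hxnot⟩
          · cases k
            · exact ⟨hxnot, huv'.2⟩
            · exact ⟨huv'.2, hxnot⟩
          · exact hE e he)
        (by
          intro w
          have h1 := hdeg w
          by_cases hw : w = x
          · subst hw
            simp only [Multiset.countP_cons, hcount]
            split_ifs <;> omega
          · cases k <;> simp [Multiset.countP_cons, StellationTree.short, Ne.symm hw] at h1 ⊢
            · exact h1
            · split_ifs at h1 <;> omega)
        (by
          convert hstep using 1
          ext e
          simp only [Set.mem_ofPred_eq, Multiset.mem_cons, Set.mem_insert_iff, Prod.mk.injEq]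
          constructor
          · rintro ⟨T', ⟨h1, -⟩ | ⟨h1, -⟩ | h1⟩
            · exact Or.inl h1
            · exact Or.inr (Or.inl h1)
            · exact Or.inr (Or.inr ⟨T', h1⟩)
          · rintro (h1 | h1 | ⟨T', h1⟩)
            · exact ⟨l, Or.inl ⟨h1, rfl⟩⟩
            · exact ⟨r, Or.inr (Or.inl ⟨h1, rfl⟩)⟩
            · exact ⟨T', Or.inr (Or.inr h1)⟩)
      refine ⟨g, ?_⟩
      convert hg using 1
      ext e
      simp only [Set.mem_union, Set.mem_ofPred_eq, Multiset.mem_cons, Set.mem_insert_iff,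
        exists_eq_or_imp, StellationTree.edges]
      tauto

/-- Every single-source outerplanar DAG admits a linear extension whose
maximum twist size is at most 3. -/
theorem single_source_odag_twist_le_three (E : Finset (ℕ × ℕ))
    (hE : IsSingleSourceODAG E) :
    ∃ f, LinExt E f ∧ TwistLE E f 3 := by
  obtain ⟨A, hA⟩ := hE
  obtain ⟨⟨s, t⟩, T, hst, hnd, hET, -⟩ := hA.hasStellationTree
  simp only [Multiset.nodup_cons, Multiset.mem_cons, not_or] at hst hnd
  have hbase : SweepInv {(s, t)} {(s, t)} (fun a => if a = s then 0 else 1) := by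
    refine ⟨subset_rfl, ?_, ?_, ?_, ?_, ?_, ?_, ?_⟩
    · rintro a b ⟨e, rfl, ha⟩ ⟨e, rfl, hb⟩ hab
      rcases ha with rfl | rfl <;> rcases hb with rfl | rfl <;> simp_all
    · rintro a b h
      obtain ⟨rfl, rfl⟩ := Prod.mk.inj h
      simp [Ne.symm hst]
    · exact fun a b h => Or.inl h
    · rintro a b c d h h'
      obtain ⟨rfl, rfl⟩ := Prod.mk.inj h
      simp
    · rintro a b c d s' h h'
      obtain ⟨rfl, rfl⟩ := Prod.mk.inj h
      simp
    · rintro c y - s₁ t₁ s₂ t₂ s₃ t₃ h1 h2 - h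
      obtain ⟨rfl, rfl⟩ := Prod.mk.inj h1
      obtain ⟨rfl, rfl⟩ := Prod.mk.inj h2
      exact absurd h (lt_irrefl _)
    · rintro s₁ t₁ s₂ t₂ s₃ t₃ s₄ t₄ h1 h2 - - h
      obtain ⟨rfl, rfl⟩ := Prod.mk.inj h1
      obtain ⟨rfl, rfl⟩ := Prod.mk.inj h2
      exact absurd h (lt_irrefl _)
  obtain ⟨g, hg⟩ := exists_layout_of_pending T.size {((s, t), T)} {(s, t)} _ (by simp)
    (by simpa using hnd.2.2) (by simpa using ⟨hnd.1.2, hnd.2.1⟩)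
    (fun v => (Multiset.countP_le_card _ _).trans (by simp))
    (by
      convert hbase using 1
      ext e
      simp)
  have hEg : ∀ e, e ∈ E ↔ e ∈ ({(s, t)} ∪
      {e | ∃ p ∈ ({((s, t), T)} : Multiset _), e ∈ p.2.edges p.1} : Set (ℕ × ℕ)) := by
    intro e
    simp [hET]
  let f : ℕ → ℕ := fun a => if a ∈ verts E then 2 * g a else 2 * a + 1
  have hf : ∀ a b, (a, b) ∈ E → f a = 2 * g a ∧ f b = 2 * g b := fun a b hab =>
    ⟨if_pos (mem_verts_iff.2 ⟨_, hab, Or.inl rfl⟩), if_pos (mem_verts_iff.2 ⟨_, hab, Or.inr rfl⟩)⟩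
  refine ⟨f, ⟨?_, ?_⟩, ?_⟩
  · intro a b hab
    simp only [f] at hab
    split_ifs at hab with ha hb hb
    · obtain ⟨e, he, hae⟩ := mem_verts_iff.1 ha
      obtain ⟨e', he', hbe⟩ := mem_verts_iff.1 hb
      exact hg.inj a b ⟨e, (hEg e).1 he, hae⟩ ⟨e', (hEg e').1 he', hbe⟩ (by omega)
    all_goals omega
  · rintro ⟨a, b⟩ hab
    have := hf a b hab
    have := hg.mono a b ((hEg _).1 hab)
    simp only
    omega
  · rintro m σ τ ⟨hmem, hσ, hτ, hlt⟩
    by_contra hm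
    have hm : 4 ≤ m := by omega
    let i : Fin 4 → Fin m := Fin.castLE hm
    have hi : StrictMono i := Fin.strictMono_castLE hm
    have hfi : ∀ j, f (σ j) = 2 * g (σ j) ∧ f (τ j) = 2 * g (τ j) := fun j => hf _ _ (hmem j)
    have hσ' : ∀ j k : Fin 4, j < k → g (σ (i j)) < g (σ (i k)) := fun j k hjk => by
      have h1 : f (σ (i j)) < f (σ (i k)) := hσ (hi hjk)
      have := hfi (i j)
      have := hfi (i k)
      omega
    have hτ' : ∀ j k : Fin 4, j < k → g (τ (i j)) < g (τ (i k)) := fun j k hjk => by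
      have h1 : f (τ (i j)) < f (τ (i k)) := hτ (hi hjk)
      have := hfi (i j)
      have := hfi (i k)
      omega
    have hmem' : ∀ j : Fin 4, _ := fun j => (hEg _).1 (hmem (i j))
    refine hg.twist _ _ _ _ _ _ _ _ (hmem' 0) (hmem' 1) (hmem' 2) (hmem' 3)
      (hσ' 0 1 (by decide)) (hσ' 1 2 (by decide)) (hσ' 2 3 (by decide)) ?_
      (hτ' 0 1 (by decide)) (hτ' 1 2 (by decide)) (hτ' 2 3 (by decide))
    have h1 := hlt (i 3) (i 0)
    have := hfi (i 3)
    have := hfi (i 0)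
    omega
end

section
/- If every single-source outerplanar DAG admits a 4-stack layout, then every outerplanar DAG with s sources admits a 4s-stack layout: partition the oDAG into s single-source subgraphs and embed each in a separate set of 4 stacks, using a common linear extension. -/
/-- Construction of maximal outerplanar DAGs using all three stellation
operations (transitive, monotone sink, monotone source). -/
inductive ODAGBuild : Finset (ℕ × ℕ) → Finset (ℕ × ℕ) → Prop
  | base (s t : ℕ) (h : s ≠ t) : ODAGBuild {(s, t)} {(s, t)}
  | transitive (E A : Finset (ℕ × ℕ)) (u v x : ℕ) (hE : ODAGBuild E A)
      (hA : (u, v) ∈ A) (hx : x ∉ verts E) :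
      ODAGBuild (insert (u, x) (insert (x, v) E))
        (insert (u, x) (insert (x, v) (A.erase (u, v))))
  | monoSink (E A : Finset (ℕ × ℕ)) (u v x : ℕ) (hE : ODAGBuild E A)
      (hA : (u, v) ∈ A) (hx : x ∉ verts E) :
      ODAGBuild (insert (u, x) (insert (v, x) E))
        (insert (u, x) (insert (v, x) (A.erase (u, v))))
  | monoSource (E A : Finset (ℕ × ℕ)) (u v x : ℕ) (hE : ODAGBuild E A)
      (hA : (u, v) ∈ A) (hx : x ∉ verts E) :
      ODAGBuild (insert (x, u) (insert (x, v) E))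
        (insert (x, u) (insert (x, v) (A.erase (u, v))))

/-- An outerplanar DAG. -/
def IsODAG (E : Finset (ℕ × ℕ)) : Prop := ∃ A, ODAGBuild E A

open Classical in
/-- The sources (vertices with in-degree 0) of `E`. -/
noncomputable def sources (E : Finset (ℕ × ℕ)) : Finset ℕ :=
  (verts E).filter (fun v => ∀ u, (u, v) ∉ E)

theorem mem_verts_insert {y : ℕ} {e : ℕ × ℕ} {E : Finset (ℕ × ℕ)} :
    y ∈ verts (insert e E) ↔ y = e.1 ∨ y = e.2 ∨ y ∈ verts E := by
  simp only [verts, Finset.image_insert, Finset.mem_union, Finset.mem_insert]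
  tauto

theorem mem_verts_union {y : ℕ} {E F : Finset (ℕ × ℕ)} :
    y ∈ verts (E ∪ F) ↔ y ∈ verts E ∨ y ∈ verts F := by
  simp only [verts, Finset.image_union, Finset.mem_union]
  tauto

theorem mem_verts_singleton {y : ℕ} {e : ℕ × ℕ} :
    y ∈ verts {e} ↔ y = e.1 ∨ y = e.2 := by
  simp [verts]

theorem verts_mono {E F : Finset (ℕ × ℕ)} (h : E ⊆ F) : verts E ⊆ verts F :=
  Finset.union_subset_union (Finset.image_subset_image h) (Finset.image_subset_image h)

theorem fst_mem_verts {E : Finset (ℕ × ℕ)} {a b : ℕ} (h : (a, b) ∈ E) : a ∈ verts E :=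
  Finset.mem_union_left _ (Finset.mem_image_of_mem Prod.fst h)

theorem snd_mem_verts {E : Finset (ℕ × ℕ)} {a b : ℕ} (h : (a, b) ∈ E) : b ∈ verts E :=
  Finset.mem_union_right _ (Finset.mem_image_of_mem Prod.snd h)

/-! ### Amalgamation of vertex orders -/

/-- An injective key into a linear order yields, on a finite set, an order-compatible
injective position function. -/
theorem exists_injective_position {L : Type*} [LinearOrder L] (S : Finset ℕ) (k : ℕ → L)
    (hk : Function.Injective k) :
    ∃ h : ℕ → ℕ, Function.Injective h ∧ ∀ a ∈ S, ∀ b ∈ S, k a < k b → h a < h b := by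
  have key : ∀ a ∈ S, ∀ b, k a < k b →
      (S.filter (fun z => k z < k a)).card < (S.filter (fun z => k z < k b)).card := by
    intro a ha b hab
    apply Finset.card_lt_card
    rw [Finset.ssubset_iff_of_subset]
    · exact ⟨a, by simp [ha, hab], by simp⟩
    · intro z hz
      simp only [Finset.mem_filter] at hz ⊢
      exact ⟨hz.1, hz.2.trans hab⟩
  have bound : ∀ a ∈ S, (S.filter (fun z => k z < k a)).card < S.card := by
    intro a ha
    apply Finset.card_lt_card
    rw [Finset.ssubset_iff_of_subset (Finset.filter_subset _ _)]
    exact ⟨a, ha, by simp⟩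
  refine ⟨fun a => if a ∈ S then (S.filter (fun z => k z < k a)).card else S.card + a, ?_, ?_⟩
  · intro a b hab
    by_cases ha : a ∈ S <;> by_cases hb : b ∈ S <;> simp only [ha, hb, if_true, if_false] at hab
    · rcases lt_trichotomy (k a) (k b) with h | h | h
      · have := key a ha b h
        omega
      · exact hk h
      · have := key b hb a h
        omega
    · have := bound a ha
      omega
    · have := bound b hb
      omega
    · omega
  · intro a ha b hb hab
    simpa only [ha, hb, if_true] using key a ha b hab

/-- Two vertex orders that agree on the common part of `V` and `W` have a common extension. -/
theorem exists_amalgam (V W : Finset ℕ) (f g : ℕ → ℕ) (hf : Function.Injective f)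
    (hg : Function.Injective g)
    (hfg : ∀ a ∈ V, a ∈ W → ∀ b ∈ V, b ∈ W → g a < g b → f a < f b) :
    ∃ h : ℕ → ℕ, Function.Injective h ∧ (∀ a ∈ V, ∀ b ∈ V, f a < f b → h a < h b) ∧
      ∀ a ∈ W, ∀ b ∈ W, g a < g b → h a < h b := by
  let p : ℕ → ℕ := fun w => ((V ∩ W).filter (fun v => g v < g w)).sup (fun v => f v + 1)
  let k : ℕ → ℕ ×ₗ ℕ := fun a => if a ∈ V then toLex (f a + 1, 0) else toLex (p a, g a + 1)
  have hk : Function.Injective k := by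
    intro a b hab
    by_cases ha : a ∈ V <;> by_cases hb : b ∈ V <;>
      simp only [k, ha, hb, if_true, if_false, EmbeddingLike.apply_eq_iff_eq, Prod.mk.injEq] at hab
    · exact hf (by omega)
    · omega
    · omega
    · exact hg (by omega)
  obtain ⟨h, hinj, hmono⟩ := exists_injective_position (V ∪ W) k hk
  refine ⟨h, hinj, fun a ha b hb hab => ?_, fun a ha b hb hab => ?_⟩
  · apply hmono a (Finset.mem_union_left _ ha) b (Finset.mem_union_left _ hb)
    simp only [k, ha, hb, if_true, Prod.Lex.toLex_lt_toLex]
    left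
    omega
  · apply hmono a (Finset.mem_union_right _ ha) b (Finset.mem_union_right _ hb)
    by_cases hav : a ∈ V <;> by_cases hbv : b ∈ V <;>
      simp only [k, hav, hbv, if_true, if_false, Prod.Lex.toLex_lt_toLex]
    · have := hfg a hav ha b hbv hb hab
      left
      omega
    · have : f a + 1 ≤ p b :=
        Finset.le_sup (f := fun v => f v + 1) (by simp [hav, ha, hab])
      omega
    · left
      apply (Finset.sup_lt_iff (Nat.succ_pos _)).2
      intro v hv
      simp only [Finset.mem_filter, Finset.mem_inter] at hv
      have := hfg v hv.1.1 hv.1.2 b hbv hb (hv.2.trans hab)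
      omega
    · have : p a ≤ p b := by
        apply Finset.sup_mono
        intro z hz
        simp only [Finset.mem_filter] at hz ⊢
        exact ⟨hz.1, hz.2.trans hab⟩
      omega

/-! ### Extending layouts of a subgraph -/

/-- Every linear extension of `B` extends to one of `F` for which the edges of `F` outside
`B` fit into `4 * n` stacks. -/
def Extends (n : ℕ) (B F : Finset (ℕ × ℕ)) : Prop :=
  B ⊆ F ∧ ∀ f, LinExt B f → ∃ (g : ℕ → ℕ) (c : ℕ × ℕ → ℕ), LinExt F g ∧
    (∀ a ∈ verts B, ∀ b ∈ verts B, f a < f b → g a < g b) ∧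
    (∀ e ∈ F, e ∉ B → c e < 4 * n) ∧
    ∀ e ∈ F, e ∉ B → ∀ e' ∈ F, e' ∉ B → c e = c e' → ¬ Crosses g e e'

theorem Extends.refl (B : Finset (ℕ × ℕ)) : Extends 0 B B :=
  ⟨subset_rfl, fun f hf => ⟨f, fun _ => 0, hf, fun _ _ _ _ h => h,
    fun _ h h' => absurd h h', fun _ h h' => absurd h h'⟩⟩

theorem lt_of_order_compatible {S : Finset ℕ} {f g : ℕ → ℕ} (hf : Function.Injective f)
    (h : ∀ a ∈ S, ∀ b ∈ S, f a < f b → g a < g b) {a b : ℕ} (ha : a ∈ S) (hb : b ∈ S)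
    (hab : g a < g b) : f a < f b := by
  rcases lt_trichotomy (f a) (f b) with h' | h' | h'
  · exact h'
  · rw [hf h'] at hab
    exact absurd hab (lt_irrefl _)
  · exact absurd (h b hb a ha h') (by omega)

theorem crosses_of_order_compatible {B : Finset (ℕ × ℕ)} {f g : ℕ → ℕ}
    (hf : Function.Injective f)
    (h : ∀ a ∈ verts B, ∀ b ∈ verts B, f a < f b → g a < g b) {e e' : ℕ × ℕ}
    (he : e ∈ B) (he' : e' ∈ B) (hc : Crosses g e e') : Crosses f e e' := by
  have h1 : e.1 ∈ verts B := fst_mem_verts he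
  have h2 : e.2 ∈ verts B := snd_mem_verts he
  have h3 : e'.1 ∈ verts B := fst_mem_verts he'
  have h4 : e'.2 ∈ verts B := snd_mem_verts he'
  have key := @lt_of_order_compatible (verts B) f g hf h
  rcases hc with ⟨p, q, r⟩ | ⟨p, q, r⟩
  · exact Or.inl ⟨key h1 h3 p, key h3 h2 q, key h2 h4 r⟩
  · exact Or.inr ⟨key h3 h1 p, key h1 h4 q, key h4 h2 r⟩

/-- Attach an extension of a subgraph `C` of `F` that meets `F` only in `C`. -/
theorem Extends.attach {n m : ℕ} {B F C D : Finset (ℕ × ℕ)} (hF : Extends n B F)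
    (hD : Extends m C D) (hC : C ⊆ F) (hV : ∀ y ∈ verts F, y ∈ verts D → y ∈ verts C) :
    Extends (n + m) B (F ∪ D) := by
  refine ⟨hF.1.trans Finset.subset_union_left, fun f hf => ?_⟩
  obtain ⟨g, c, hg, hfg, hc, hcv⟩ := hF.2 f hf
  obtain ⟨g', c', hg', hgg', hc', hcv'⟩ := hD.2 g ⟨hg.1, fun e he => hg.2 e (hC he)⟩
  obtain ⟨h, hh, h1, h2⟩ := exists_amalgam (verts F) (verts D) g g' hg.1 hg'.1
    (fun a ha ha' b hb hb' hab =>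
      lt_of_order_compatible hg.1 hgg' (hV a ha ha') (hV b hb hb') hab)
  have hFv : ∀ e ∈ F, e.1 ∈ verts F ∧ e.2 ∈ verts F :=
    fun e he => ⟨fst_mem_verts he, snd_mem_verts he⟩
  have hDv : ∀ e ∈ D, e.1 ∈ verts D ∧ e.2 ∈ verts D :=
    fun e he => ⟨fst_mem_verts he, snd_mem_verts he⟩
  have split : ∀ e ∈ F ∪ D, e ∉ F → e ∈ D ∧ e ∉ C := fun e he he' =>
    ⟨(Finset.mem_union.1 he).resolve_left he', fun h => he' (hC h)⟩
  refine ⟨h, fun e => if e ∈ F then c e else 4 * n + c' e, ⟨hh, ?_⟩, ?_, ?_, ?_⟩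
  · intro e he
    rcases Finset.mem_union.1 he with he | he
    · exact h1 _ (hFv e he).1 _ (hFv e he).2 (hg.2 e he)
    · exact h2 _ (hDv e he).1 _ (hDv e he).2 (hg'.2 e he)
  · intro a ha b hb hab
    exact h1 a (verts_mono hF.1 ha) b (verts_mono hF.1 hb) (hfg a ha b hb hab)
  · intro e he heB
    by_cases heF : e ∈ F
    · have := hc e heF heB
      simp only [heF, if_true]
      omega
    · have := hc' e (split e he heF).1 (split e he heF).2
      simp only [heF, if_false]
      omega
  · intro e he heB e' he' heB' hcc hcr
    by_cases heF : e ∈ F <;> by_cases heF' : e' ∈ F <;>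
      simp only [heF, heF', if_true, if_false] at hcc
    · exact hcv e heF heB e' heF' heB' hcc (crosses_of_order_compatible hg.1 h1 heF heF' hcr)
    · have := hc e heF heB
      omega
    · have := hc e' heF' heB'
      omega
    · obtain ⟨hd, hdC⟩ := split e he heF
      obtain ⟨hd', hdC'⟩ := split e' he' heF'
      exact hcv' e hd hdC e' hd' hdC' (by omega) (crosses_of_order_compatible hg'.1 h2 hd hd' hcr)

/-- Lay out the core `B` in four stacks of its own. -/
theorem Extends.hasStackLayout {n : ℕ} {B F : Finset (ℕ × ℕ)} (hF : Extends n B F)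
    (hB : HasStackLayout B 4) : HasStackLayout F (4 * (n + 1)) := by
  obtain ⟨f, d, hf, hd, hdv⟩ := hB
  obtain ⟨g, c, hg, hfg, hc, hcv⟩ := hF.2 f hf
  refine ⟨g, fun e => if e ∈ B then 4 * n + d e else c e, hg, ?_, ?_⟩
  · intro e he
    by_cases heB : e ∈ B
    · have := hd e heB
      simp only [heB, if_true]
      omega
    · have := hc e he heB
      simp only [heB, if_false]
      omega
  · intro e he e' he' hcc hcr
    by_cases heB : e ∈ B <;> by_cases heB' : e' ∈ B <;>
      simp only [heB, heB', if_true, if_false] at hcc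
    · exact hdv e heB e' heB' (by omega) (crosses_of_order_compatible hf.1 hfg heB heB' hcr)
    · have := hc e' he' heB'
      omega
    · have := hc e he heB
      omega
    · exact hcv e he heB e' he' heB' hcc hcr

theorem HasStackLayout.mono {F : Finset (ℕ × ℕ)} {k l : ℕ} (h : HasStackLayout F k)
    (hkl : k ≤ l) : HasStackLayout F l := by
  obtain ⟨f, c, hf, hc, hv⟩ := h
  exact ⟨f, c, hf, fun e he => (hc e he).trans_le hkl, hv⟩

theorem HasStackLayout.extends_edge {F : Finset (ℕ × ℕ)} {n u v : ℕ}
    (h : HasStackLayout F (4 * n)) (he : (u, v) ∈ F) : Extends n {(u, v)} F := by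
  obtain ⟨g, c, hg, hc, hv⟩ := h
  refine ⟨by simpa using he, fun f hf => ⟨g, c, hg, ?_, fun e he _ => hc e he,
    fun e he _ e' he' _ => hv e he e' he'⟩⟩
  have h1 : f u < f v := hf.2 (u, v) (by simp)
  have h2 : g u < g v := hg.2 (u, v) he
  intro a ha b hb hab
  rw [mem_verts_singleton] at ha hb
  rcases ha with rfl | rfl <;> rcases hb with rfl | rfl <;> omega

/-- Join two extensions whose graphs share only the vertex `x`, closing the triangle `u x v`. -/
theorem Extends.triangle {n₁ n₂ u v x : ℕ} {B₁ F₁ B₂ F₂ : Finset (ℕ × ℕ)}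
    (h₁ : Extends n₁ B₁ F₁) (h₂ : Extends n₂ B₂ F₂)
    (hd : ∀ y ∈ verts F₁, y ∈ verts F₂ → y = x)
    (hu : u ∈ verts B₁) (hx₁ : x ∈ verts B₁) (hv : v ∈ verts B₂) (hx₂ : x ∈ verts B₂) :
    Extends (n₁ + n₂) (insert (u, v) (B₁ ∪ B₂)) (insert (u, v) (F₁ ∪ F₂)) := by
  have s₁ := verts_mono h₁.1
  have s₂ := verts_mono h₂.1
  have key := ((Extends.refl (insert (u, v) (B₁ ∪ B₂))).attach h₁
    (fun e he => by simp [he]) ?_).attach h₂ (fun e he => by simp [he]) ?_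
  · convert key using 1
    · omega
    · ext e
      have t₁ := @h₁.1 e
      have t₂ := @h₂.1 e
      simp only [Finset.mem_insert, Finset.mem_union]
      tauto
  · intro y hy hy'
    simp only [mem_verts_insert, mem_verts_union] at hy
    rcases hy with rfl | rfl | hy | hy
    · exact hu
    · exact hd _ hy' (s₂ hv) ▸ hx₁
    · exact hy
    · exact hd _ hy' (s₂ hy) ▸ hx₁
  · intro y hy hy'
    simp only [mem_verts_insert, mem_verts_union] at hy
    rcases hy with (rfl | rfl | hy | hy) | hy
    · exact hd _ (s₁ hu) hy' ▸ hx₂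
    · exact hv
    · exact hd _ (s₁ hy) hy' ▸ hx₂
    · exact hy
    · exact hd _ hy hy' ▸ hx₂

/-! ### Single-source blocks -/

theorem SSBuild.subset {E A : Finset (ℕ × ℕ)} (h : SSBuild E A) : A ⊆ E := by
  induction h with
  | base => exact subset_rfl
  | transitive E A u v x _ _ _ ih | monoSink E A u v x _ _ _ ih =>
    exact Finset.insert_subset_insert _
      (Finset.insert_subset_insert _ ((Finset.erase_subset _ _).trans ih))

/-- `B` can be glued onto any unstellated outerface edge `(u, v)` of a single-source graph. -/
def Gluable (B : Finset (ℕ × ℕ)) (u v : ℕ) : Prop :=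
  ∀ E A, SSBuild E A → (u, v) ∈ A → (∀ y ∈ verts E, y ∈ verts B → y = u ∨ y = v) →
    ∃ A', SSBuild (E ∪ B) A' ∧ A.erase (u, v) ⊆ A'

/-- `B` is a single-source graph in which the outerface edge `(u, v)` is still unstellated. -/
def FreeAt (B : Finset (ℕ × ℕ)) (u v : ℕ) : Prop := ∃ A, SSBuild B A ∧ (u, v) ∈ A

theorem FreeAt.mem {B : Finset (ℕ × ℕ)} {u v : ℕ} (h : FreeAt B u v) : (u, v) ∈ B := by
  obtain ⟨A, hA, h⟩ := h
  exact hA.subset h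

theorem freeAt_singleton {u v : ℕ} (h : u ≠ v) : FreeAt {(u, v)} u v :=
  ⟨_, SSBuild.base u v h, by simp⟩

theorem gluable_singleton (u v : ℕ) : Gluable {(u, v)} u v := by
  intro E A hE hA _
  refine ⟨A, ?_, Finset.erase_subset _ _⟩
  rwa [Finset.union_eq_left.2 (by simpa using hE.subset hA)]

/-- Gluing blocks onto both new edges of a stellation. -/
theorem gluable_triangle {B₁ B₂ : Finset (ℕ × ℕ)} {u v x a b : ℕ}
    (hab : (a, b) = (x, v) ∨ (a, b) = (v, x))
    (hst : ∀ E A, SSBuild E A → (u, v) ∈ A → x ∉ verts E →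
      SSBuild (insert (u, x) (insert (a, b) E))
        (insert (u, x) (insert (a, b) (A.erase (u, v)))))
    (h₁ : Gluable B₁ u x) (h₂ : Gluable B₂ a b) (hm₁ : (u, x) ∈ B₁) (hm₂ : (a, b) ∈ B₂)
    (hux : u ≠ x) (hvx : v ≠ x)
    (hd : ∀ y ∈ verts B₁, y ∈ verts B₂ → y = x) :
    Gluable (insert (u, v) (B₁ ∪ B₂)) u v := by
  intro E A hE hA hV
  have hE' := hE.subset
  have hu₁ : u ∈ verts B₁ := fst_mem_verts hm₁
  have hx₁ : x ∈ verts B₁ := snd_mem_verts hm₁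
  have ha₂ : a ∈ verts B₂ := fst_mem_verts hm₂
  have hb₂ : b ∈ verts B₂ := snd_mem_verts hm₂
  have hab' : (a = x ∧ b = v) ∨ (a = v ∧ b = x) := by simpa using hab
  have hv₂ : v ∈ verts B₂ := by rcases hab' with ⟨rfl, rfl⟩ | ⟨rfl, rfl⟩ <;> assumption
  have hu₂ : u ∉ verts B₂ := fun h => hux (hd u hu₁ h)
  have hv₁ : v ∉ verts B₁ := fun h => hvx (hd v h hv₂)
  have huv : u ≠ v := fun h => hu₂ (h ▸ hv₂)
  simp only [mem_verts_insert, mem_verts_union] at hV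
  have hxE : x ∉ verts E := fun h => by
    rcases hV x h (by tauto) with h | h
    · exact hux h.symm
    · exact hvx h.symm
  have hV₁ : ∀ y ∈ verts E, y ∈ verts B₁ → y = u := fun y hy hy' =>
    (hV y hy (by simp only [hy', true_or, or_true])).resolve_right fun h => hv₁ (h ▸ hy')
  have hV₂ : ∀ y ∈ verts E, y ∈ verts B₂ → y = v := fun y hy hy' =>
    (hV y hy (by simp only [hy', or_true])).resolve_left fun h => hu₂ (h ▸ hy')
  obtain ⟨A₁, hA₁, hs₁⟩ := h₁ _ _ (hst E A hE hA hxE) (by simp) (by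
    intro y hy hy'
    have hyv : y ≠ v := fun h => hv₁ (h ▸ hy')
    simp only [mem_verts_insert] at hy
    rcases hy with hy | hy | hy | hy | hy
    · exact Or.inl hy
    · exact Or.inr hy
    · omega
    · omega
    · exact Or.inl (hV₁ y hy hy'))
  have hne : (a, b) ≠ (u, x) := by
    rintro h
    rw [Prod.mk.injEq] at h
    omega
  obtain ⟨A₂, hA₂, hs₂⟩ := h₂ _ _ hA₁ (hs₁ (by simp [hne])) (by
    intro y hy hy'
    have hyu : y ≠ u := fun h => hu₂ (h ▸ hy')
    simp only [mem_verts_union, mem_verts_insert] at hy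
    have : y = x ∨ y = v := by
      rcases hy with (hy | hy | hy | hy | hy) | hy
      · exact absurd hy hyu
      · exact Or.inl hy
      · omega
      · omega
      · exact Or.inr (hV₂ y hy hy')
      · exact Or.inl (hd y hy hy')
    omega)
  refine ⟨A₂, ?_, ?_⟩
  · convert hA₂ using 1
    have huvE := hE' hA
    clear * - hm₁ hm₂ huvE
    ext e
    simp only [Finset.mem_insert, Finset.mem_union]
    constructor
    · rintro (h | rfl | h | h) <;> simp_all
    · rintro (((rfl | rfl | h) | h) | h) <;> simp_all
  · intro e he
    have heE : e ∈ E := hE' (Finset.mem_of_mem_erase he)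
    have hn₁ : e ≠ (u, x) := fun h => hxE (snd_mem_verts (h ▸ heE))
    have hn₂ : e ≠ (a, b) := by
      rintro rfl
      rcases hab' with ⟨rfl, rfl⟩ | ⟨rfl, rfl⟩
      · exact hxE (fst_mem_verts heE)
      · exact hxE (snd_mem_verts heE)
    apply hs₂
    rw [Finset.mem_erase]
    refine ⟨hn₂, hs₁ ?_⟩
    rw [Finset.mem_erase]
    exact ⟨hn₁, by simp only [Finset.mem_insert]; tauto⟩

/-- After a stellation producing `(u, v)` and `(a, b)`, glue a block onto `(a, b)` only. -/
theorem freeAt_triangle {B₁ B₂ A : Finset (ℕ × ℕ)} {u v a b : ℕ}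
    (hB : SSBuild (insert (u, v) (insert (a, b) B₁)) A) (huv : (u, v) ∈ A) (hab : (a, b) ∈ A)
    (hne : (u, v) ≠ (a, b)) (h₂ : Gluable B₂ a b) (hm₂ : (a, b) ∈ B₂)
    (hu : u ∈ verts B₂ → u = a ∨ u = b) (hv : v ∈ verts B₂ → v = a ∨ v = b)
    (hd : ∀ y ∈ verts B₁, y ∈ verts B₂ → y = a ∨ y = b) :
    FreeAt (insert (u, v) (B₁ ∪ B₂)) u v := by
  obtain ⟨A', hA', hs⟩ := h₂ _ _ hB hab (by
    intro y hy hy'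
    simp only [mem_verts_insert] at hy
    rcases hy with rfl | rfl | rfl | rfl | hy
    · exact hu hy'
    · exact hv hy'
    · exact Or.inl rfl
    · exact Or.inr rfl
    · exact hd y hy hy')
  refine ⟨A', ?_, hs (by simp [hne, huv])⟩
  convert hA' using 1
  ext e
  simp only [Finset.mem_insert, Finset.mem_union]
  constructor
  · tauto
  · rintro ((h | rfl | h) | h) <;> tauto

/-! ### Recursive structure of outerplanar DAGs -/

/-- `F` is an outerplanar DAG hanging on one side of its edge `(u, v)`, and all edges in `A`
are unstellated outerface edges of it. -/
inductive Hang : ℕ → ℕ → Finset (ℕ × ℕ) → Finset (ℕ × ℕ) → Prop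
  | edge (u v : ℕ) (A : Finset (ℕ × ℕ)) (h : u ≠ v) (hA : A ⊆ {(u, v)}) : Hang u v {(u, v)} A
  | transitive (u v x : ℕ) (F₁ F₂ A₁ A₂ A : Finset (ℕ × ℕ)) (h₁ : Hang u x F₁ A₁)
      (h₂ : Hang x v F₂ A₂) (hd : ∀ y ∈ verts F₁, y ∈ verts F₂ → y = x) (hA : A ⊆ A₁ ∪ A₂) :
      Hang u v (insert (u, v) (F₁ ∪ F₂)) A
  | monoSink (u v x : ℕ) (F₁ F₂ A₁ A₂ A : Finset (ℕ × ℕ)) (h₁ : Hang u x F₁ A₁)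
      (h₂ : Hang v x F₂ A₂) (hd : ∀ y ∈ verts F₁, y ∈ verts F₂ → y = x) (hA : A ⊆ A₁ ∪ A₂) :
      Hang u v (insert (u, v) (F₁ ∪ F₂)) A
  | monoSource (u v x : ℕ) (F₁ F₂ A₁ A₂ A : Finset (ℕ × ℕ)) (h₁ : Hang x u F₁ A₁)
      (h₂ : Hang x v F₂ A₂) (hd : ∀ y ∈ verts F₁, y ∈ verts F₂ → y = x) (hA : A ⊆ A₁ ∪ A₂) :
      Hang u v (insert (u, v) (F₁ ∪ F₂)) A

theorem Hang.mem {u v : ℕ} {F A : Finset (ℕ × ℕ)} (h : Hang u v F A) : (u, v) ∈ F := by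
  cases h <;> simp

theorem Hang.ne {u v : ℕ} {F A : Finset (ℕ × ℕ)} (h : Hang u v F A) : u ≠ v := by
  induction h with
  | edge _ _ _ h => exact h
  | transitive u v x F₁ F₂ A₁ A₂ A h₁ h₂ hd hA ih₁ ih₂ =>
    rintro rfl
    exact ih₁ (hd _ (fst_mem_verts h₁.mem) (snd_mem_verts h₂.mem))
  | monoSink u v x F₁ F₂ A₁ A₂ A h₁ h₂ hd hA ih₁ ih₂ =>
    rintro rfl
    exact ih₁ (hd _ (fst_mem_verts h₁.mem) (fst_mem_verts h₂.mem))
  | monoSource u v x F₁ F₂ A₁ A₂ A h₁ h₂ hd hA ih₁ ih₂ =>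
    rintro rfl
    exact ih₁ (hd _ (snd_mem_verts h₁.mem) (snd_mem_verts h₂.mem)).symm

theorem Hang.subset {u v : ℕ} {F A : Finset (ℕ × ℕ)} (h : Hang u v F A) : A ⊆ F := by
  induction h with
  | edge _ _ _ _ hA => exact hA
  | transitive u v x F₁ F₂ A₁ A₂ A h₁ h₂ hd hA ih₁ ih₂
  | monoSink u v x F₁ F₂ A₁ A₂ A h₁ h₂ hd hA ih₁ ih₂
  | monoSource u v x F₁ F₂ A₁ A₂ A h₁ h₂ hd hA ih₁ ih₂ =>
    exact hA.trans ((Finset.union_subset_union ih₁ ih₂).trans (Finset.subset_insert _ _))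

theorem Hang.fst_ne_snd {u v : ℕ} {F A : Finset (ℕ × ℕ)} (h : Hang u v F A) :
    ∀ e ∈ F, e.1 ≠ e.2 := by
  have huv := h.ne
  induction h with
  | edge => simpa using huv
  | transitive u v x F₁ F₂ A₁ A₂ A h₁ h₂ hd hA ih₁ ih₂
  | monoSink u v x F₁ F₂ A₁ A₂ A h₁ h₂ hd hA ih₁ ih₂
  | monoSource u v x F₁ F₂ A₁ A₂ A h₁ h₂ hd hA ih₁ ih₂ =>
    intro e he
    simp only [Finset.mem_insert, Finset.mem_union] at he
    rcases he with rfl | he | he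
    · exact huv
    · exact ih₁ h₁.ne e he
    · exact ih₂ h₂.ne e he

/-- The glued graph `(F₁ ∪ F₂) ∪ G` can be split with `G` going to either side. -/
theorem exists_split_union {F₁ F₂ G A₁ A₂ C : Finset (ℕ × ℕ)} {P₁ P₂ : Finset (ℕ × ℕ) →
    Finset (ℕ × ℕ) → Prop} {a b x : ℕ} {A A' : Finset (ℕ × ℕ)}
    (hs₁ : A₁ ⊆ F₁) (hs₂ : A₂ ⊆ F₂) (p₁ : P₁ F₁ A₁) (p₂ : P₂ F₂ A₂)
    (hd : ∀ y ∈ verts F₁, y ∈ verts F₂ → y = x) (hA : A ⊆ A₁ ∪ A₂) (hab : (a, b) ∈ A)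
    (hA' : A' ⊆ A.erase (a, b) ∪ C)
    (ih₁ : (a, b) ∈ A₁ → (∀ y ∈ verts F₁, y ∈ verts G → y = a ∨ y = b) →
      P₁ (F₁ ∪ G) (A₁.erase (a, b) ∪ C))
    (ih₂ : (a, b) ∈ A₂ → (∀ y ∈ verts F₂, y ∈ verts G → y = a ∨ y = b) →
      P₂ (F₂ ∪ G) (A₂.erase (a, b) ∪ C))
    (hG : ∀ y ∈ verts (F₁ ∪ F₂), y ∈ verts G → y = a ∨ y = b) :
    ∃ F₁' F₂' A₁' A₂', P₁ F₁' A₁' ∧ P₂ F₂' A₂' ∧ F₁' ∪ F₂' = F₁ ∪ F₂ ∪ G ∧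
      (∀ y ∈ verts F₁', y ∈ verts F₂' → y = x) ∧ A' ⊆ A₁' ∪ A₂' := by
  simp only [mem_verts_union] at hG
  rcases Finset.mem_union.1 (hA hab) with h | h
  · have ha : a ∈ verts F₁ := fst_mem_verts (hs₁ h)
    have hb : b ∈ verts F₁ := snd_mem_verts (hs₁ h)
    refine ⟨F₁ ∪ G, F₂, _, A₂, ih₁ h fun y hy => hG y (Or.inl hy), p₂,
      Finset.union_right_comm _ _ _, ?_, ?_⟩
    · intro y hy hy'
      rcases mem_verts_union.1 hy with hy | hy
      · exact hd y hy hy'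
      · rcases hG y (Or.inr hy') hy with rfl | rfl
        · exact hd _ ha hy'
        · exact hd _ hb hy'
    · intro e he
      have h1 := hA' he
      have h2 := @hA e
      simp only [Finset.mem_union, Finset.mem_erase] at h1 h2 ⊢
      tauto
  · have ha : a ∈ verts F₂ := fst_mem_verts (hs₂ h)
    have hb : b ∈ verts F₂ := snd_mem_verts (hs₂ h)
    refine ⟨F₁, F₂ ∪ G, A₁, _, p₁, ih₂ h fun y hy => hG y (Or.inr hy),
      (Finset.union_assoc _ _ _).symm, ?_, ?_⟩
    · intro y hy hy'
      rcases mem_verts_union.1 hy' with hy' | hy'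
      · exact hd y hy hy'
      · rcases hG y (Or.inl hy) hy' with rfl | rfl
        · exact hd _ hy ha
        · exact hd _ hy hb
    · intro e he
      have h1 := hA' he
      have h2 := @hA e
      simp only [Finset.mem_union, Finset.mem_erase] at h1 h2 ⊢
      tauto

theorem Hang.glue {u v a b : ℕ} {F A G C : Finset (ℕ × ℕ)} (h : Hang u v F A)
    (hG : Hang a b G C) : ∀ A', A' ⊆ A.erase (a, b) ∪ C → (a, b) ∈ A →
      (∀ y ∈ verts F, y ∈ verts G → y = a ∨ y = b) → Hang u v (F ∪ G) A' := by
  have weaken : ∀ {A' : Finset (ℕ × ℕ)}, A' ⊆ C → Hang a b G A' := by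
    intro A' h'
    cases hG with
    | edge _ _ _ h hA => exact .edge _ _ _ h (h'.trans hA)
    | transitive _ _ x _ _ _ _ _ h₁ h₂ hd hA =>
      exact .transitive _ _ x _ _ _ _ _ h₁ h₂ hd (h'.trans hA)
    | monoSink _ _ x _ _ _ _ _ h₁ h₂ hd hA =>
      exact .monoSink _ _ x _ _ _ _ _ h₁ h₂ hd (h'.trans hA)
    | monoSource _ _ x _ _ _ _ _ h₁ h₂ hd hA =>
      exact .monoSource _ _ x _ _ _ _ _ h₁ h₂ hd (h'.trans hA)
  induction h with
  | edge u v A h hA =>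
    intro A' hA' hab _
    have hab' := hA hab
    rw [Finset.mem_singleton, Prod.mk.injEq] at hab'
    obtain ⟨rfl, rfl⟩ := hab'
    rw [Finset.union_eq_right.2 (by simpa using hG.mem)]
    apply weaken
    intro e he
    have h1 := hA' he
    have h2 := @hA e
    simp only [Finset.mem_union, Finset.mem_erase, Finset.mem_singleton] at h1 h2
    tauto
  | transitive u v x F₁ F₂ A₁ A₂ A h₁ h₂ hd hA ih₁ ih₂ =>
    intro A' hA' hab hV
    obtain ⟨F₁', F₂', A₁', A₂', q₁, q₂, hU, hd', hs⟩ := exists_split_union (P₁ := Hang u x)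
      (P₂ := Hang x v) h₁.subset h₂.subset h₁ h₂ hd hA hab hA' (ih₁ _ subset_rfl)
      (ih₂ _ subset_rfl) fun y hy => hV y (verts_mono (Finset.subset_insert _ _) hy)
    rw [Finset.insert_union, ← hU]
    exact .transitive _ _ x _ _ _ _ _ q₁ q₂ hd' hs
  | monoSink u v x F₁ F₂ A₁ A₂ A h₁ h₂ hd hA ih₁ ih₂ =>
    intro A' hA' hab hV
    obtain ⟨F₁', F₂', A₁', A₂', q₁, q₂, hU, hd', hs⟩ := exists_split_union (P₁ := Hang u x)
      (P₂ := Hang v x) h₁.subset h₂.subset h₁ h₂ hd hA hab hA' (ih₁ _ subset_rfl)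
      (ih₂ _ subset_rfl) fun y hy => hV y (verts_mono (Finset.subset_insert _ _) hy)
    rw [Finset.insert_union, ← hU]
    exact .monoSink _ _ x _ _ _ _ _ q₁ q₂ hd' hs
  | monoSource u v x F₁ F₂ A₁ A₂ A h₁ h₂ hd hA ih₁ ih₂ =>
    intro A' hA' hab hV
    obtain ⟨F₁', F₂', A₁', A₂', q₁, q₂, hU, hd', hs⟩ := exists_split_union (P₁ := Hang x u)
      (P₂ := Hang x v) h₁.subset h₂.subset h₁ h₂ hd hA hab hA' (ih₁ _ subset_rfl)
      (ih₂ _ subset_rfl) fun y hy => hV y (verts_mono (Finset.subset_insert _ _) hy)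
    rw [Finset.insert_union, ← hU]
    exact .monoSource _ _ x _ _ _ _ _ q₁ q₂ hd' hs

theorem ODAGBuild.exists_hang {E A : Finset (ℕ × ℕ)} (h : ODAGBuild E A) :
    ∃ s t, Hang s t E A := by
  have stellate : ∀ {E A : Finset (ℕ × ℕ)} {s t u v x : ℕ} {e₁ e₂ : ℕ × ℕ}, Hang s t E A →
      (u, v) ∈ A → x ∉ verts E →
      (u ≠ v → u ≠ x → v ≠ x → Hang u v (insert (u, v) ({e₁} ∪ {e₂})) ({e₁} ∪ {e₂})) →
      (∀ y, y = e₁.1 ∨ y = e₁.2 ∨ y = e₂.1 ∨ y = e₂.2 → y = u ∨ y = v ∨ y = x) →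
      Hang s t (insert e₁ (insert e₂ E)) (insert e₁ (insert e₂ (A.erase (u, v)))) := by
    intro E A s t u v x e₁ e₂ hE hA hx hT hV
    have hm := hE.subset hA
    have hu : u ∈ verts E := fst_mem_verts hm
    have hv : v ∈ verts E := snd_mem_verts hm
    have hux : u ≠ x := fun h => hx (h ▸ hu)
    have hvx : v ≠ x := fun h => hx (h ▸ hv)
    convert hE.glue (hT (hE.fst_ne_snd _ hm) hux hvx) (insert e₁ (insert e₂ (A.erase (u, v)))) ?_ hA ?_ using 1
    · ext e
      simp only [Finset.mem_insert, Finset.mem_union, Finset.mem_singleton]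
      constructor
      · tauto
      · rintro (h | rfl | h | h) <;> tauto
    · intro e he
      simp only [Finset.mem_insert, Finset.mem_union, Finset.mem_singleton] at he ⊢
      tauto
    · intro y hy hy'
      have hyx : y ≠ x := fun h => hx (h ▸ hy)
      have := hV y
      simp only [mem_verts_insert, mem_verts_union, mem_verts_singleton] at hy'
      tauto
  induction h with
  | base s t h => exact ⟨s, t, .edge s t _ h subset_rfl⟩
  | transitive E A u v x hE hA hx ih =>
    obtain ⟨s, t, ih⟩ := ih
    refine ⟨s, t, stellate ih hA hx (fun h1 h2 h3 => ?_) (by simp)⟩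
    refine .transitive _ _ x _ _ _ _ _ (.edge _ _ _ h2 subset_rfl)
      (.edge _ _ _ h3.symm subset_rfl) ?_ subset_rfl
    intro y hy hy'
    rw [mem_verts_singleton] at hy hy'
    dsimp only at hy hy'
    omega
  | monoSink E A u v x hE hA hx ih =>
    obtain ⟨s, t, ih⟩ := ih
    refine ⟨s, t, stellate ih hA hx (fun h1 h2 h3 => ?_) (by simp)⟩
    refine .monoSink _ _ x _ _ _ _ _ (.edge _ _ _ h2 subset_rfl)
      (.edge _ _ _ h3 subset_rfl) ?_ subset_rfl
    intro y hy hy'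
    rw [mem_verts_singleton] at hy hy'
    dsimp only at hy hy'
    omega
  | monoSource E A u v x hE hA hx ih =>
    obtain ⟨s, t, ih⟩ := ih
    refine ⟨s, t, stellate ih hA hx (fun h1 h2 h3 => ?_) (by simp)⟩
    refine .monoSource _ _ x _ _ _ _ _ (.edge _ _ _ h2.symm subset_rfl)
      (.edge _ _ _ h3.symm subset_rfl) ?_ subset_rfl
    intro y hy hy'
    rw [mem_verts_singleton] at hy hy'
    dsimp only at hy hy'
    omega

/-! ### Counting sources and the main induction -/

open Classical in
/-- The sources of `E` other than `u` and `v`. -/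
noncomputable def innerSources (E : Finset (ℕ × ℕ)) (u v : ℕ) : Finset ℕ :=
  (sources E).filter (fun y => y ≠ u ∧ y ≠ v)

theorem mem_innerSources {E : Finset (ℕ × ℕ)} {u v y : ℕ} :
    y ∈ innerSources E u v ↔ y ∈ verts E ∧ (∀ z, (z, y) ∉ E) ∧ y ≠ u ∧ y ≠ v := by
  simp [innerSources, sources, and_assoc]

theorem innerSources_comm (E : Finset (ℕ × ℕ)) (u v : ℕ) :
    innerSources E u v = innerSources E v u := by
  ext y
  simp only [mem_innerSources]
  tauto

section Triangle

variable {F₁ F₂ : Finset (ℕ × ℕ)} {u v x : ℕ}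

theorem innerSources_union_subset (hd : ∀ y ∈ verts F₁, y ∈ verts F₂ → y = x)
    (hu : u ∈ verts F₁) (hv : v ∈ verts F₂) :
    innerSources F₁ u x ∪ innerSources F₂ v x ⊆
      (innerSources (insert (u, v) (F₁ ∪ F₂)) u v).erase x := by
  intro y hy
  simp only [Finset.mem_union, mem_innerSources] at hy
  simp only [Finset.mem_erase, mem_innerSources, mem_verts_insert, mem_verts_union,
    Finset.mem_insert, Finset.mem_union, Prod.mk.injEq, not_or, not_and]
  rcases hy with ⟨h1, h2, h3, h4⟩ | ⟨h1, h2, h3, h4⟩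
  · have hyv : y ≠ v := fun h => h4 (hd y h1 (h ▸ hv))
    exact ⟨h4, by tauto, fun z => ⟨fun _ => hyv, h2 z,
      fun h => h4 (hd y h1 (snd_mem_verts h))⟩, h3, hyv⟩
  · have hyu : y ≠ u := fun h => h4 (hd y (h ▸ hu) h1)
    exact ⟨h4, by tauto, fun z => ⟨fun _ => h3,
      fun h => h4 (hd y (snd_mem_verts h) h1), h2 z⟩, hyu, h3⟩

theorem card_innerSources_union (hd : ∀ y ∈ verts F₁, y ∈ verts F₂ → y = x) :
    (innerSources F₁ u x ∪ innerSources F₂ v x).card =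
      (innerSources F₁ u x).card + (innerSources F₂ v x).card := by
  apply Finset.card_union_of_disjoint
  rw [Finset.disjoint_left]
  intro y hy hy'
  rw [mem_innerSources] at hy hy'
  exact hy.2.2.2 (hd y hy.1 hy'.1)

theorem card_innerSources_add_le (hd : ∀ y ∈ verts F₁, y ∈ verts F₂ → y = x)
    (hu : u ∈ verts F₁) (hv : v ∈ verts F₂) :
    (innerSources F₁ u x).card + (innerSources F₂ v x).card ≤
      (innerSources (insert (u, v) (F₁ ∪ F₂)) u v).card := by
  rw [← card_innerSources_union hd]
  exact Finset.card_le_card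
    ((innerSources_union_subset hd hu hv).trans (Finset.erase_subset _ _))

theorem card_innerSources_add_lt (hd : ∀ y ∈ verts F₁, y ∈ verts F₂ → y = x)
    (hu : u ∈ verts F₁) (hv : v ∈ verts F₂) (hx : x ∈ verts F₁) (hux : u ≠ x) (hvx : v ≠ x)
    (h₁ : ∀ y, (y, x) ∉ F₁) (h₂ : ∀ y, (y, x) ∉ F₂) :
    (innerSources F₁ u x).card + (innerSources F₂ v x).card <
      (innerSources (insert (u, v) (F₁ ∪ F₂)) u v).card := by
  rw [← card_innerSources_union hd]
  refine (Finset.card_le_card (innerSources_union_subset hd hu hv)).trans_lt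
    (Finset.card_erase_lt_of_mem ?_)
  simp only [mem_innerSources, mem_verts_insert, mem_verts_union,
    Finset.mem_insert, Finset.mem_union, Prod.mk.injEq, not_or, not_and]
  exact ⟨by tauto, fun z => ⟨fun _ => hvx.symm, h₁ z, h₂ z⟩, hux.symm, hvx.symm⟩

end Triangle

/-- The block at `(u, v)` may be glued onto a block on the other side of `(u, v)`; the
remaining blocks are paid for by inner sources. -/
def HasGluableBlock (u v : ℕ) (F : Finset (ℕ × ℕ)) : Prop :=
  ∃ B n, Extends n B F ∧ Gluable B u v ∧ FreeAt B u v ∧ n ≤ (innerSources F u v).card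

/-- All blocks, including the one at `(u, v)`, are paid for by inner sources. -/
def HasPaidBlock (u v : ℕ) (F : Finset (ℕ × ℕ)) : Prop :=
  ∃ B n, Extends n B F ∧ FreeAt B u v ∧ n + 1 ≤ (innerSources F u v).card

theorem HasPaidBlock.hasGluableBlock {u v : ℕ} {F : Finset (ℕ × ℕ)}
    (hyp : ∀ E' : Finset (ℕ × ℕ), IsSingleSourceODAG E' → HasStackLayout E' 4)
    (huv : u ≠ v) (h : HasPaidBlock u v F) : HasGluableBlock u v F := by
  obtain ⟨B, n, hB, hf, hn⟩ := h
  have hm := hB.1 hf.mem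
  obtain ⟨A, hA, -⟩ := hf
  exact ⟨_, n + 1, (hB.hasStackLayout (hyp B ⟨A, hA⟩)).extends_edge hm,
    gluable_singleton u v, freeAt_singleton huv, hn⟩

theorem FreeAt.transitive_triangle {B₁ B₂ : Finset (ℕ × ℕ)} {u v x : ℕ} (h₁ : FreeAt B₁ u x)
    (h₂ : Gluable B₂ x v) (hm : (x, v) ∈ B₂)
    (hd : ∀ y ∈ verts B₁, y ∈ verts B₂ → y = x) (hux : u ≠ x) (hvx : v ≠ x) :
    FreeAt (insert (u, v) (B₁ ∪ B₂)) u v := by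
  have hu : u ∈ verts B₁ := fst_mem_verts h₁.mem
  have hv : v ∈ verts B₂ := snd_mem_verts hm
  obtain ⟨A, hA, hx⟩ := h₁
  refine freeAt_triangle (SSBuild.monoSink _ _ u x v hA hx fun h => hvx (hd v h hv))
    (by simp) (by simp) (by simp [hux]) h₂ hm (fun h => Or.inl (hd u hu h))
    (fun _ => Or.inr rfl) (fun y hy hy' => Or.inl (hd y hy hy'))

theorem FreeAt.monoSink_triangle {B₁ B₂ : Finset (ℕ × ℕ)} {u v x : ℕ} (h₁ : FreeAt B₁ u x)
    (h₂ : Gluable B₂ v x) (hm : (v, x) ∈ B₂)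
    (hd : ∀ y ∈ verts B₁, y ∈ verts B₂ → y = x) (hvx : v ≠ x) :
    FreeAt (insert (u, v) (B₁ ∪ B₂)) u v := by
  have hu : u ∈ verts B₁ := fst_mem_verts h₁.mem
  have hv : v ∈ verts B₂ := fst_mem_verts hm
  obtain ⟨A, hA, hx⟩ := h₁
  refine freeAt_triangle (SSBuild.transitive _ _ u x v hA hx fun h => hvx (hd v h hv))
    (by simp) (by simp) (by simp [hvx]) h₂ hm (fun h => Or.inr (hd u hu h))
    (fun _ => Or.inl rfl) (fun y hy hy' => Or.inr (hd y hy hy'))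

theorem FreeAt.monoSource_triangle_left {B₁ B₂ : Finset (ℕ × ℕ)} {u v x : ℕ}
    (h₁ : FreeAt B₁ x u) (h₂ : Gluable B₂ x v) (hm : (x, v) ∈ B₂)
    (hd : ∀ y ∈ verts B₁, y ∈ verts B₂ → y = x) (hux : u ≠ x) (hvx : v ≠ x) :
    FreeAt (insert (u, v) (B₁ ∪ B₂)) u v := by
  have hu : u ∈ verts B₁ := snd_mem_verts h₁.mem
  have hv : v ∈ verts B₂ := snd_mem_verts hm
  obtain ⟨A, hA, hx⟩ := h₁
  have := SSBuild.monoSink _ _ x u v hA hx fun h => hvx (hd v h hv)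
  rw [Finset.insert_comm] at this
  exact freeAt_triangle this
    (by simp) (by simp) (by simp [hux]) h₂ hm (fun h => Or.inl (hd u hu h))
    (fun _ => Or.inr rfl) (fun y hy hy' => Or.inl (hd y hy hy'))

theorem FreeAt.monoSource_triangle_right {B₁ B₂ : Finset (ℕ × ℕ)} {u v x : ℕ}
    (h₁ : Gluable B₁ x u) (hm : (x, u) ∈ B₁) (h₂ : FreeAt B₂ x v)
    (hd : ∀ y ∈ verts B₁, y ∈ verts B₂ → y = x) (hux : u ≠ x) :
    FreeAt (insert (u, v) (B₁ ∪ B₂)) u v := by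
  have hu : u ∈ verts B₁ := snd_mem_verts hm
  have hv : v ∈ verts B₂ := snd_mem_verts h₂.mem
  obtain ⟨A, hA, hx⟩ := h₂
  have := SSBuild.transitive _ _ x v u hA hx fun h => hux (hd u hu h)
  rw [Finset.insert_comm] at this
  rw [Finset.union_comm]
  exact freeAt_triangle this
    (by simp) (by simp) (by simp [hux]) h₁ hm (fun _ => Or.inr rfl)
    (fun h => Or.inl (hd v h hv)) (fun y hy hy' => Or.inl (hd y hy' hy))

theorem Hang.blocks {u v : ℕ} {F A : Finset (ℕ × ℕ)}
    (hyp : ∀ E' : Finset (ℕ × ℕ), IsSingleSourceODAG E' → HasStackLayout E' 4)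
    (h : Hang u v F A) :
    HasGluableBlock u v F ∧ (HasPaidBlock u v F ∨ ∀ y, (y, u) ∉ F) := by
  induction h with
  | edge u v A h hA =>
    refine ⟨⟨_, 0, .refl _, gluable_singleton u v, freeAt_singleton h, Nat.zero_le _⟩, Or.inr ?_⟩
    intro y hy
    simp only [Finset.mem_singleton, Prod.mk.injEq] at hy
    exact h hy.2
  | transitive u v x F₁ F₂ A₁ A₂ A h₁ h₂ hd hA ih₁ ih₂ =>
    obtain ⟨⟨B₁, n₁, e₁, g₁, f₁, c₁⟩, i₁⟩ := ih₁
    obtain ⟨⟨B₂, n₂, e₂, g₂, f₂, c₂⟩, -⟩ := ih₂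
    have hux := h₁.ne
    have hvx := h₂.ne.symm
    have hcard := card_innerSources_add_le hd (fst_mem_verts h₁.mem) (snd_mem_verts h₂.mem)
    rw [innerSources_comm F₂] at hcard
    have hd' : ∀ {B}, B ⊆ F₁ → ∀ y ∈ verts B, y ∈ verts B₂ → y = x := fun hB y hy hy' =>
      hd y (verts_mono hB hy) (verts_mono e₂.1 hy')
    have hext : ∀ {B n}, Extends n B F₁ → FreeAt B u x → _ := fun {B n} e f =>
      e.triangle e₂ hd (fst_mem_verts f.mem) (snd_mem_verts f.mem) (snd_mem_verts f₂.mem)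
        (fst_mem_verts f₂.mem)
    refine ⟨⟨_, _, hext e₁ f₁, ?_, f₁.transitive_triangle g₂ f₂.mem (hd' e₁.1) hux hvx,
      by omega⟩, ?_⟩
    · exact gluable_triangle (Or.inl rfl)
        (fun E A hE hA hx => SSBuild.transitive E A u v x hE hA hx) g₁ g₂ f₁.mem f₂.mem hux hvx
        (hd' e₁.1)
    · rcases i₁ with ⟨B, n, e, f, c⟩ | i₁
      · exact Or.inl ⟨_, _, hext e f, f.transitive_triangle g₂ f₂.mem (hd' e.1) hux hvx, by omega⟩
      · right
        intro y hy
        simp only [Finset.mem_insert, Finset.mem_union, Prod.mk.injEq] at hy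
        rcases hy with ⟨-, rfl⟩ | hy | hy
        · exact hux (hd _ (fst_mem_verts h₁.mem) (snd_mem_verts h₂.mem))
        · exact i₁ y hy
        · exact hux (hd _ (fst_mem_verts h₁.mem) (snd_mem_verts hy))
  | monoSink u v x F₁ F₂ A₁ A₂ A h₁ h₂ hd hA ih₁ ih₂ =>
    obtain ⟨⟨B₁, n₁, e₁, g₁, f₁, c₁⟩, i₁⟩ := ih₁
    obtain ⟨⟨B₂, n₂, e₂, g₂, f₂, c₂⟩, -⟩ := ih₂
    have hux := h₁.ne
    have hvx := h₂.ne
    have hcard := card_innerSources_add_le hd (fst_mem_verts h₁.mem) (fst_mem_verts h₂.mem)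
    have hd' : ∀ {B}, B ⊆ F₁ → ∀ y ∈ verts B, y ∈ verts B₂ → y = x := fun hB y hy hy' =>
      hd y (verts_mono hB hy) (verts_mono e₂.1 hy')
    have hext : ∀ {B n}, Extends n B F₁ → FreeAt B u x → _ := fun {B n} e f =>
      e.triangle e₂ hd (fst_mem_verts f.mem) (snd_mem_verts f.mem) (fst_mem_verts f₂.mem)
        (snd_mem_verts f₂.mem)
    refine ⟨⟨_, _, hext e₁ f₁, ?_, f₁.monoSink_triangle g₂ f₂.mem (hd' e₁.1) hvx,
      by omega⟩, ?_⟩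
    · exact gluable_triangle (Or.inr rfl)
        (fun E A hE hA hx => SSBuild.monoSink E A u v x hE hA hx) g₁ g₂ f₁.mem f₂.mem hux hvx
        (hd' e₁.1)
    · rcases i₁ with ⟨B, n, e, f, c⟩ | i₁
      · exact Or.inl ⟨_, _, hext e f, f.monoSink_triangle g₂ f₂.mem (hd' e.1) hvx, by omega⟩
      · right
        intro y hy
        simp only [Finset.mem_insert, Finset.mem_union, Prod.mk.injEq] at hy
        rcases hy with ⟨-, rfl⟩ | hy | hy
        · exact hux (hd _ (fst_mem_verts h₁.mem) (fst_mem_verts h₂.mem))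
        · exact i₁ y hy
        · exact hux (hd _ (fst_mem_verts h₁.mem) (snd_mem_verts hy))
  | monoSource u v x F₁ F₂ A₁ A₂ A h₁ h₂ hd hA ih₁ ih₂ =>
    obtain ⟨⟨B₁, n₁, e₁, g₁, f₁, c₁⟩, i₁⟩ := ih₁
    obtain ⟨⟨B₂, n₂, e₂, g₂, f₂, c₂⟩, i₂⟩ := ih₂
    have hux := h₁.ne.symm
    have hvx := h₂.ne.symm
    have huF : u ∈ verts F₁ := snd_mem_verts h₁.mem
    have hvF : v ∈ verts F₂ := snd_mem_verts h₂.mem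
    have hcard := card_innerSources_add_le hd huF hvF
    rw [innerSources_comm F₁, innerSources_comm F₂] at hcard
    have hd' : ∀ {B C}, B ⊆ F₁ → C ⊆ F₂ → ∀ y ∈ verts B, y ∈ verts C → y = x :=
      fun hB hC y hy hy' => hd y (verts_mono hB hy) (verts_mono hC hy')
    have hext : ∀ {B C n m}, Extends n B F₁ → FreeAt B x u → Extends m C F₂ → FreeAt C x v → _ :=
      fun {B C n m} e f e' f' =>
      e.triangle e' hd (snd_mem_verts f.mem) (fst_mem_verts f.mem) (snd_mem_verts f'.mem)
        (fst_mem_verts f'.mem)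
    have hpaid : HasPaidBlock u v (insert (u, v) (F₁ ∪ F₂)) := by
      rcases i₁ with ⟨B, n, e, f, c⟩ | i₁
      · exact ⟨_, _, hext e f e₂ f₂,
          f.monoSource_triangle_left g₂ f₂.mem (hd' e.1 e₂.1) hux hvx, by omega⟩
      rcases i₂ with ⟨B, n, e, f, c⟩ | i₂
      · exact ⟨_, _, hext e₁ f₁ e f,
          .monoSource_triangle_right g₁ f₁.mem f (hd' e₁.1 e.1) hux, by omega⟩
      have hlt := card_innerSources_add_lt hd huF hvF (fst_mem_verts h₁.mem) hux hvx i₁ i₂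
      rw [innerSources_comm F₁, innerSources_comm F₂] at hlt
      exact ⟨_, _, hext e₁ f₁ e₂ f₂,
        f₁.monoSource_triangle_left g₂ f₂.mem (hd' e₁.1 e₂.1) hux hvx, by omega⟩
    have huv : u ≠ v := fun h => hux (hd u huF (h ▸ hvF))
    exact ⟨hpaid.hasGluableBlock hyp huv, Or.inl hpaid⟩

/-- If every single-source outerplanar DAG admits a 4-stack layout, then every
outerplanar DAG with `s` sources admits a `4*s`-stack layout. -/
theorem odag_four_s_stacks
    (hyp : ∀ E' : Finset (ℕ × ℕ), IsSingleSourceODAG E' → HasStackLayout E' 4)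
    (E : Finset (ℕ × ℕ)) (hE : IsODAG E) (s : ℕ) (hs : (sources E).card = s) :
    HasStackLayout E (4 * s) := by
  obtain ⟨A, hA⟩ := hE
  obtain ⟨u, v, h⟩ := hA.exists_hang
  have hsub : innerSources E u v ⊆ sources E := Finset.filter_subset _ _
  obtain ⟨⟨B, n, hB, -, ⟨A', hA', -⟩, hn⟩, ⟨C, m, hC, ⟨A'', hA'', -⟩, hm⟩ | hu⟩ := h.blocks hyp
  · have := Finset.card_le_card hsub
    exact (hC.hasStackLayout (hyp C ⟨_, hA''⟩)).mono (by omega)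
  · have hus : u ∈ sources E := by
      simp only [sources, Finset.mem_filter]
      exact ⟨fst_mem_verts h.mem, hu⟩
    have : (innerSources E u v).card < (sources E).card :=
      Finset.card_lt_card ((Finset.ssubset_iff_of_subset hsub).2
        ⟨u, hus, fun h => (mem_innerSources.1 h).2.2.1 rfl⟩)
    exact (hB.hasStackLayout (hyp B ⟨_, hA'⟩)).mono (by omega)
end

section
/- Every outerpath DAG admits a linear extension whose maximum twist size is at most 4. -/
/-- Construction of outerpath DAGs: `OPBuild E e` means `E` is constructible
from a base edge with `e` the currently stellatable outerface edge.  At each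
step the active edge `(u,v)` is stellated with a fresh vertex `x` (with one of
the three acyclic orientations of the two new edges), and exactly one of the
two new edges becomes the next active edge, so that the weak dual is a path. -/
inductive OPBuild : Finset (ℕ × ℕ) → ℕ × ℕ → Prop
  | base (s t : ℕ) (h : s ≠ t) : OPBuild {(s, t)} (s, t)
  | transL (E : Finset (ℕ × ℕ)) (u v x : ℕ) (hE : OPBuild E (u, v)) (hx : x ∉ verts E) :
      OPBuild (insert (u, x) (insert (x, v) E)) (u, x)
  | transR (E : Finset (ℕ × ℕ)) (u v x : ℕ) (hE : OPBuild E (u, v)) (hx : x ∉ verts E) :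
      OPBuild (insert (u, x) (insert (x, v) E)) (x, v)
  | sinkL (E : Finset (ℕ × ℕ)) (u v x : ℕ) (hE : OPBuild E (u, v)) (hx : x ∉ verts E) :
      OPBuild (insert (u, x) (insert (v, x) E)) (u, x)
  | sinkR (E : Finset (ℕ × ℕ)) (u v x : ℕ) (hE : OPBuild E (u, v)) (hx : x ∉ verts E) :
      OPBuild (insert (u, x) (insert (v, x) E)) (v, x)
  | srcL (E : Finset (ℕ × ℕ)) (u v x : ℕ) (hE : OPBuild E (u, v)) (hx : x ∉ verts E) :
      OPBuild (insert (x, u) (insert (x, v) E)) (x, u)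
  | srcR (E : Finset (ℕ × ℕ)) (u v x : ℕ) (hE : OPBuild E (u, v)) (hx : x ∉ verts E) :
      OPBuild (insert (x, u) (insert (x, v) E)) (x, v)

/-- An outerpath DAG. -/
def IsOuterpathDAG (E : Finset (ℕ × ℕ)) : Prop := ∃ e, OPBuild E e

/-- The edge `e` is incident to the vertex `x`. -/
def IncidentTo (e : ℕ × ℕ) (x : ℕ) : Prop := e.1 = x ∨ e.2 = x

/-- The vertex `w` is placed by `f` weakly between `u` and `v`. -/
def Between (f : ℕ → ℕ) (u v w : ℕ) : Prop := f u ≤ f w ∧ f w ≤ f v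

lemma Crosses.symm {f : ℕ → ℕ} {e e' : ℕ × ℕ} (h : Crosses f e e') : Crosses f e' e :=
  Or.symm h

lemma Crosses.not_incidentTo {f : ℕ → ℕ} {e e' : ℕ × ℕ} (h : Crosses f e e') {x : ℕ}
    (hx : IncidentTo e x) : ¬ IncidentTo e' x := by
  unfold IncidentTo at *
  unfold Crosses at h
  rintro (h' | h') <;> rcases hx with hx | hx <;> subst hx <;> rw [h'] at h <;> omega

lemma IsTwist.crosses {E : Finset (ℕ × ℕ)} {f : ℕ → ℕ} {m : ℕ} {s t : Fin m → ℕ}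
    (h : IsTwist E f m s t) {i j : Fin m} (hij : i ≠ j) :
    Crosses f (s i, t i) (s j, t j) := by
  obtain ⟨-, hs, ht, hst⟩ := h
  rcases lt_or_gt_of_ne hij with hlt | hlt
  · exact Or.inl ⟨hs hlt, hst _ _, ht hlt⟩
  · exact Or.inr ⟨hs hlt, hst _ _, ht hlt⟩

/-- A family of pairwise crossing edges, each of which is incident to one of three given
vertices or lies in a set of pairwise non-crossing edges, has at most four members. -/
lemma card_le_four_of_crosses {f : ℕ → ℕ} {m : ℕ} {g : Fin m → ℕ × ℕ}
    (hg : ∀ i j, i ≠ j → Crosses f (g i) (g j)) {Z : Set (ℕ × ℕ)} {x p q : ℕ}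
    (hZ : ∀ e ∈ Z, ∀ e' ∈ Z, ¬ Crosses f e e')
    (hcov : ∀ i, IncidentTo (g i) x ∨ g i ∈ Z ∨ IncidentTo (g i) p ∨ IncidentTo (g i) q) :
    m ≤ 4 := by
  classical
  let c : Fin m → Fin 4 := fun i =>
    if IncidentTo (g i) x then 0 else if g i ∈ Z then 1 else if IncidentTo (g i) p then 2 else 3
  have hc : Function.Injective c := by
    intro i j hij
    by_contra hne
    have hcr := hg i j hne
    have hi := hcov i
    have hj := hcov j
    have hx := hcr.not_incidentTo (x := x)
    have hp := hcr.not_incidentTo (x := p)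
    have hq := hcr.not_incidentTo (x := q)
    have hz : g i ∈ Z → g j ∉ Z := fun a b => hZ _ a _ b hcr
    simp only [c] at hij
    split_ifs at hij <;> tauto
  simpa using Fintype.card_le_of_injective c hc

/-- Move the vertex `x` to the new position `2 * k`, keeping the order of all other vertices. -/
def insertAt (f : ℕ → ℕ) (x k : ℕ) (y : ℕ) : ℕ := if y = x then 2 * k else 2 * f y + 1

lemma insertAt_self (f : ℕ → ℕ) (x k : ℕ) : insertAt f x k x = 2 * k := by simp [insertAt]

lemma insertAt_of_ne (f : ℕ → ℕ) {x y : ℕ} (k : ℕ) (h : y ≠ x) :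
    insertAt f x k y = 2 * f y + 1 := by simp [insertAt, h]

lemma insertAt_injective {f : ℕ → ℕ} (hf : Function.Injective f) (x k : ℕ) :
    Function.Injective (insertAt f x k) := by
  intro a b h
  unfold insertAt at h
  split_ifs at h with ha hb hb
  · rw [ha, hb]
  · omega
  · omega
  · exact hf (by omega)

lemma crosses_insertAt {f : ℕ → ℕ} {x : ℕ} (k : ℕ) {e e' : ℕ × ℕ}
    (he : ¬ IncidentTo e x) (he' : ¬ IncidentTo e' x) :
    Crosses (insertAt f x k) e e' ↔ Crosses f e e' := by
  unfold IncidentTo at he he'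
  push Not at he he'
  unfold Crosses
  rw [insertAt_of_ne f k he.1, insertAt_of_ne f k he.2, insertAt_of_ne f k he'.1,
    insertAt_of_ne f k he'.2]
  omega

lemma not_incidentTo_of_notMem_verts {E : Finset (ℕ × ℕ)} {x : ℕ} (hx : x ∉ verts E)
    {e : ℕ × ℕ} (he : e ∈ E) : ¬ IncidentTo e x := by
  rintro (rfl | rfl)
  · exact hx (Finset.mem_union_left _ (Finset.mem_image_of_mem _ he))
  · exact hx (Finset.mem_union_right _ (Finset.mem_image_of_mem _ he))

/-- The edges of `E` with an endpoint between `u` and `v` split into a set `Z` of pairwise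
non-crossing edges lying between `u` and `v` and edges incident to `p` or `q`. -/
structure Separated (E : Finset (ℕ × ℕ)) (f : ℕ → ℕ) (u v : ℕ) (Z : Set (ℕ × ℕ))
    (p q : ℕ) : Prop where
  subset : ∀ e ∈ Z, e ∈ E
  between : ∀ e ∈ Z, Between f u v e.1 ∧ Between f u v e.2
  noncrossing : ∀ e ∈ Z, ∀ e' ∈ Z, ¬ Crosses f e e'
  incident : ∀ e ∈ E, Between f u v e.1 ∨ Between f u v e.2 →
    e ∈ Z ∨ IncidentTo e p ∨ IncidentTo e q

/-- If no vertex is placed strictly between `u` and `v`, no non-crossing edges are needed. -/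
lemma Separated.of_consecutive {E : Finset (ℕ × ℕ)} {f : ℕ → ℕ} {u v : ℕ}
    (h : ∀ w, Between f u v w → w = u ∨ w = v) : Separated E f u v ∅ u v where
  subset := by simp
  between := by simp
  noncrossing := by simp
  incident e _ he := by
    rcases he with he | he <;> rcases h _ he with h | h <;> simp [IncidentTo, h]

/-- Inserting a fresh vertex `x`, adjacent only to `u` and `v`, close to the interval between
`u` and `v` preserves the bound on the twist size. -/
lemma Separated.twistLE_insertAt {E E' : Finset (ℕ × ℕ)} {f : ℕ → ℕ} {u v p q x k : ℕ}
    {Z : Set (ℕ × ℕ)} (hS : Separated E f u v Z p q) (hT : TwistLE E f 4) (huv : (u, v) ∈ E)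
    (hlt : f u < f v) (hx : x ∉ verts E) (hk : f u ≤ k) (hk' : k ≤ f v + 1)
    (hE' : ∀ e ∈ E', e ∈ E ∨ IncidentTo e x ∧ (e.1 = u ∨ e.1 = v ∨ e.2 = u ∨ e.2 = v)) :
    TwistLE E' (insertAt f x k) 4 := by
  have hni : ∀ e ∈ E, ¬ IncidentTo e x := fun e he => not_incidentTo_of_notMem_verts hx he
  have hux : u ≠ x := fun h => hni _ huv (Or.inl h)
  have hvx : v ≠ x := fun h => hni _ huv (Or.inr h)
  intro m s t hst
  by_cases hold : ∀ i, (s i, t i) ∈ E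
  · have hpos : ∀ i, insertAt f x k (s i) = 2 * f (s i) + 1 ∧
        insertAt f x k (t i) = 2 * f (t i) + 1 := fun i =>
      ⟨insertAt_of_ne f k fun h => hni _ (hold i) (Or.inl h),
        insertAt_of_ne f k fun h => hni _ (hold i) (Or.inr h)⟩
    obtain ⟨-, hs, ht, hst⟩ := hst
    refine hT m s t ⟨hold, fun i j hij => ?_, fun i j hij => ?_, fun i j => ?_⟩
    · have := hs hij
      simp only [Function.comp, hpos] at this ⊢
      omega
    · have := ht hij
      simp only [Function.comp, hpos] at this ⊢
      omega
    · have := hst i j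
      simp only [hpos] at this
      omega
  · push Not at hold
    obtain ⟨i₀, hi₀⟩ := hold
    obtain ⟨hinc, hends⟩ := (hE' _ (hst.1 i₀)).resolve_left hi₀
    refine card_le_four_of_crosses (g := fun i => (s i, t i)) (x := x) (p := p) (q := q) (Z := Z)
      (fun i j hij => hst.crosses hij)
      (fun e he e' he' => (crosses_insertAt k (hni _ (hS.subset _ he))
        (hni _ (hS.subset _ he'))).not.2 (hS.noncrossing e he e' he')) fun i => ?_
    by_cases hi : i = i₀
    · exact Or.inl (hi ▸ hinc)
    rcases hE' _ (hst.1 i) with he | he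
    · refine Or.inr (hS.incident _ he ?_)
      have hc := hst.crosses hi
      have h1 : s i ≠ x := fun h => hni _ he (Or.inl h)
      have h2 : t i ≠ x := fun h => hni _ he (Or.inr h)
      have key : ∀ w, (w = u ∨ w = v ∨ w = x) →
          2 * f u ≤ insertAt f x k w ∧ insertAt f x k w ≤ 2 * f v + 2 := by
        rintro w (rfl | rfl | rfl)
        · rw [insertAt_of_ne f k hux]; omega
        · rw [insertAt_of_ne f k hvx]; omega
        · rw [insertAt_self]; omega
      unfold IncidentTo at hinc
      have hst₀ : s i₀ ≠ t i₀ := fun h => (hst.2.2.2 i₀ i₀).ne (by rw [h])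
      have hs₀ := key (s i₀) (by grind)
      have ht₀ := key (t i₀) (by grind)
      unfold Crosses at hc
      simp only [insertAt_of_ne f k h1, insertAt_of_ne f k h2] at hc
      unfold Between
      dsimp only
      omega
    · exact Or.inl he.1

lemma linExt_insertAt {E : Finset (ℕ × ℕ)} {f : ℕ → ℕ} {x k : ℕ} {e₁ e₂ : ℕ × ℕ}
    (hf : LinExt E f) (hx : x ∉ verts E) (h₁ : insertAt f x k e₁.1 < insertAt f x k e₁.2)
    (h₂ : insertAt f x k e₂.1 < insertAt f x k e₂.2) :
    LinExt (insert e₁ (insert e₂ E)) (insertAt f x k) := by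
  refine ⟨insertAt_injective hf.1 x k, fun e he => ?_⟩
  simp only [Finset.mem_insert] at he
  rcases he with rfl | rfl | he
  · exact h₁
  · exact h₂
  · have hni := not_incidentTo_of_notMem_verts hx he
    have := hf.2 e he
    rw [insertAt_of_ne f k fun h => hni (Or.inl h), insertAt_of_ne f k fun h => hni (Or.inr h)]
    omega

/-- Extending the non-crossing set by the two edges at a fresh vertex `x` that is placed next to
one end of the interval between `u` and `v`; the new interval is that between `u'` and `v'`. -/
lemma Separated.insert_edges {E : Finset (ℕ × ℕ)} {f : ℕ → ℕ} {u v u' v' p q x k : ℕ}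
    {Z : Set (ℕ × ℕ)} {e₁ e₂ : ℕ × ℕ} (hS : Separated E f u v Z p q)
    (huv : (u, v) ∈ E) (hlt : f u < f v) (hx : x ∉ verts E)
    (h : (k = f v + 1 ∧ u' = u ∧ v' = x ∧ e₁ = (u, x) ∧ e₂ = (v, x)) ∨
      (k = f u ∧ u' = x ∧ v' = v ∧ e₁ = (x, u) ∧ e₂ = (x, v))) :
    Separated (insert e₁ (insert e₂ E)) (insertAt f x k) u' v' (insert e₁ (insert e₂ Z)) p q := by
  have hni : ∀ e ∈ E, ¬ IncidentTo e x := fun e he => not_incidentTo_of_notMem_verts hx he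
  have hu := insertAt_of_ne f k fun h => hni _ huv (Or.inl h)
  have hv := insertAt_of_ne f k fun h => hni _ huv (Or.inr h)
  have hxk := insertAt_self f x k
  have hold : ∀ e ∈ E, insertAt f x k e.1 = 2 * f e.1 + 1 ∧
      insertAt f x k e.2 = 2 * f e.2 + 1 := fun e he =>
    ⟨insertAt_of_ne f k fun h => hni _ he (Or.inl h),
      insertAt_of_ne f k fun h => hni _ he (Or.inr h)⟩
  have hZ : ∀ e ∈ Z, Between f u v e.1 ∧ Between f u v e.2 ∧
      insertAt f x k e.1 = 2 * f e.1 + 1 ∧ insertAt f x k e.2 = 2 * f e.2 + 1 :=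
    fun e he => ⟨(hS.between e he).1, (hS.between e he).2, hold e (hS.subset e he)⟩
  dsimp only at hu hv
  unfold Between at hZ
  refine ⟨?_, ?_, ?_, ?_⟩
  · rintro e (rfl | rfl | he)
    · simp
    · simp
    · simp [hS.subset e he]
  · unfold Between
    rintro e (rfl | rfl | he)
    · rcases h with ⟨rfl, rfl, rfl, rfl, rfl⟩ | ⟨rfl, rfl, rfl, rfl, rfl⟩ <;> dsimp only <;> omega
    · rcases h with ⟨rfl, rfl, rfl, rfl, rfl⟩ | ⟨rfl, rfl, rfl, rfl, rfl⟩ <;> dsimp only <;> omega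
    · have := hZ e he
      rcases h with ⟨rfl, rfl, rfl, rfl, rfl⟩ | ⟨rfl, rfl, rfl, rfl, rfl⟩ <;> omega
  · have hnew : ∀ e ∈ Z, ¬ Crosses (insertAt f x k) e₁ e ∧
        ¬ Crosses (insertAt f x k) e₂ e := by
      intro e he
      have := hZ e he
      unfold Crosses
      rcases h with ⟨rfl, rfl, rfl, rfl, rfl⟩ | ⟨rfl, rfl, rfl, rfl, rfl⟩ <;> dsimp only <;> omega
    have hx₁ : IncidentTo e₁ x := by
      rcases h with ⟨-, -, -, rfl, -⟩ | ⟨-, -, -, rfl, -⟩ <;> simp [IncidentTo]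
    have hx₂ : IncidentTo e₂ x := by
      rcases h with ⟨-, -, -, -, rfl⟩ | ⟨-, -, -, -, rfl⟩ <;> simp [IncidentTo]
    have hmem : ∀ e ∈ insert e₁ (insert e₂ Z), IncidentTo e x ∧ (e = e₁ ∨ e = e₂) ∨ e ∈ Z := by
      rintro e (rfl | rfl | he)
      · exact Or.inl ⟨hx₁, Or.inl rfl⟩
      · exact Or.inl ⟨hx₂, Or.inr rfl⟩
      · exact Or.inr he
    intro e he e' he' hc
    rcases hmem e he with ⟨hex, heq⟩ | heZ <;> rcases hmem e' he' with ⟨hex', heq'⟩ | heZ'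
    · exact hc.not_incidentTo hex hex'
    · rcases heq with rfl | rfl
      · exact (hnew e' heZ').1 hc
      · exact (hnew e' heZ').2 hc
    · rcases heq' with rfl | rfl
      · exact (hnew e heZ).1 hc.symm
      · exact (hnew e heZ).2 hc.symm
    · exact hS.noncrossing e heZ e' heZ' ((crosses_insertAt k (hni _ (hS.subset _ heZ))
        (hni _ (hS.subset _ heZ'))).1 hc)
  · intro e he hb
    simp only [Finset.mem_insert] at he
    rcases he with rfl | rfl | he
    · exact Or.inl (by simp)
    · exact Or.inl (by simp)
    · have := hold e he
      refine (hS.incident e he ?_).imp_left fun h => by simp [h]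
      unfold Between at *
      rcases h with ⟨rfl, rfl, rfl, rfl, rfl⟩ | ⟨rfl, rfl, rfl, rfl, rfl⟩ <;> omega

/-- The greedy order: each new vertex is placed next to an endpoint of the active edge. -/
lemma OPBuild.exists_layout {E : Finset (ℕ × ℕ)} {a : ℕ × ℕ} (h : OPBuild E a) :
    ∃ f, LinExt E f ∧ TwistLE E f 4 ∧ a ∈ E ∧ ∃ Z p q, Separated E f a.1 a.2 Z p q := by
  have consecutive : ∀ {f : ℕ → ℕ} {x k w : ℕ}, Function.Injective f → w ≠ x →
      (k = f w → ∀ y, Between (insertAt f x k) x w y → y = x ∨ y = w) ∧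
      (k = f w + 1 → ∀ y, Between (insertAt f x k) w x y → y = w ∨ y = x) := by
    intro f x k w hf hw
    have hwk := insertAt_of_ne f k hw
    have hxk := insertAt_self f x k
    refine ⟨fun hk y hy => ?_, fun hk y hy => ?_⟩ <;> by_cases hyx : y = x <;>
      simp only [hyx, true_or, or_true, false_or, or_false] <;>
      · have hyk := insertAt_of_ne f k hyx
        unfold Between at hy
        exact hf (by omega)
  have step : ∀ {E : Finset (ℕ × ℕ)} {f : ℕ → ℕ} {u v x k p q : ℕ} {Z : Set (ℕ × ℕ)}
      {e₁ e₂ : ℕ × ℕ}, LinExt E f → TwistLE E f 4 → (u, v) ∈ E → Separated E f u v Z p q →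
      x ∉ verts E →
      (e₁ = (u, x) ∧ e₂ = (x, v) ∧ f u < k ∧ k ≤ f v ∨
        e₁ = (u, x) ∧ e₂ = (v, x) ∧ k = f v + 1 ∨
        e₁ = (x, u) ∧ e₂ = (x, v) ∧ k = f u) →
      LinExt (insert e₁ (insert e₂ E)) (insertAt f x k) ∧
        TwistLE (insert e₁ (insert e₂ E)) (insertAt f x k) 4 := by
    intro E f u v x k p q Z e₁ e₂ hf hT huv hS hx h
    have hlt := hf.2 _ huv
    have hni := not_incidentTo_of_notMem_verts hx huv
    have hu := insertAt_of_ne f k fun h => hni (Or.inl h)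
    have hv := insertAt_of_ne f k fun h => hni (Or.inr h)
    have hxk := insertAt_self f x k
    dsimp only at hlt hu hv
    refine ⟨linExt_insertAt hf hx ?_ ?_,
      hS.twistLE_insertAt hT huv hlt hx (by omega) (by omega) fun e he => ?_⟩
    · rcases h with ⟨rfl, rfl, h⟩ | ⟨rfl, rfl, h⟩ | ⟨rfl, rfl, h⟩ <;> dsimp only <;> omega
    · rcases h with ⟨rfl, rfl, h⟩ | ⟨rfl, rfl, h⟩ | ⟨rfl, rfl, h⟩ <;> dsimp only <;> omega
    · simp only [Finset.mem_insert] at he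
      unfold IncidentTo
      rcases he with rfl | rfl | he
      · rcases h with ⟨rfl, -⟩ | ⟨rfl, -⟩ | ⟨rfl, -⟩ <;> simp
      · rcases h with ⟨-, rfl, -⟩ | ⟨-, rfl, -⟩ | ⟨-, rfl, -⟩ <;> simp
      · exact Or.inl he
  induction h with
  | base s t h =>
    refine ⟨fun y => if y = s then 0 else if y = t then 1 else y + 2, ⟨?_, ?_⟩, ?_, by simp,
      ∅, s, t, by simp, by simp, by simp, ?_⟩
    · intro a b hab
      dsimp only at hab
      split_ifs at hab <;> omega
    · simp [h.symm]
    · intro m s' t' hst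
      refine card_le_four_of_crosses (g := fun i => (s' i, t' i)) (Z := ∅) (x := s) (p := s)
        (q := s) (fun i j hij => hst.crosses hij) (by simp) fun i => Or.inl ?_
      have := hst.1 i
      simp only [Finset.mem_singleton, Prod.mk.injEq] at this
      exact Or.inl this.1
    · simp [IncidentTo]
  | transL E u v x hE hx ih =>
    obtain ⟨f, hf, hT, huv, Z, p, q, hS⟩ := ih
    have hni := not_incidentTo_of_notMem_verts hx huv
    obtain ⟨hlin, htw⟩ := step hf hT huv hS hx (k := f u + 1)
      (Or.inl ⟨rfl, rfl, by have := hf.2 _ huv; grind⟩)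
    exact ⟨_, hlin, htw, by simp, ∅, _, _,
      .of_consecutive ((consecutive hf.1 (fun h => hni (Or.inl h))).2 rfl)⟩
  | transR E u v x hE hx ih =>
    obtain ⟨f, hf, hT, huv, Z, p, q, hS⟩ := ih
    have hni := not_incidentTo_of_notMem_verts hx huv
    obtain ⟨hlin, htw⟩ := step hf hT huv hS hx (k := f v)
      (Or.inl ⟨rfl, rfl, by have := hf.2 _ huv; grind⟩)
    exact ⟨_, hlin, htw, by simp, ∅, _, _,
      .of_consecutive ((consecutive hf.1 (fun h => hni (Or.inr h))).1 rfl)⟩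
  | sinkL E u v x hE hx ih =>
    obtain ⟨f, hf, hT, huv, Z, p, q, hS⟩ := ih
    obtain ⟨hlin, htw⟩ := step hf hT huv hS hx (k := f v + 1) (Or.inr (Or.inl ⟨rfl, rfl, rfl⟩))
    exact ⟨_, hlin, htw, by simp, _, p, q, hS.insert_edges huv (hf.2 _ huv) hx
      (Or.inl ⟨rfl, rfl, rfl, rfl, rfl⟩)⟩
  | sinkR E u v x hE hx ih =>
    obtain ⟨f, hf, hT, huv, Z, p, q, hS⟩ := ih
    have hni := not_incidentTo_of_notMem_verts hx huv
    obtain ⟨hlin, htw⟩ := step hf hT huv hS hx (k := f v + 1) (Or.inr (Or.inl ⟨rfl, rfl, rfl⟩))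
    exact ⟨_, hlin, htw, by simp, ∅, _, _,
      .of_consecutive ((consecutive hf.1 (fun h => hni (Or.inr h))).2 rfl)⟩
  | srcL E u v x hE hx ih =>
    obtain ⟨f, hf, hT, huv, Z, p, q, hS⟩ := ih
    have hni := not_incidentTo_of_notMem_verts hx huv
    obtain ⟨hlin, htw⟩ := step hf hT huv hS hx (k := f u) (Or.inr (Or.inr ⟨rfl, rfl, rfl⟩))
    exact ⟨_, hlin, htw, by simp, ∅, _, _,
      .of_consecutive ((consecutive hf.1 (fun h => hni (Or.inl h))).1 rfl)⟩
  | srcR E u v x hE hx ih =>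
    obtain ⟨f, hf, hT, huv, Z, p, q, hS⟩ := ih
    obtain ⟨hlin, htw⟩ := step hf hT huv hS hx (k := f u) (Or.inr (Or.inr ⟨rfl, rfl, rfl⟩))
    exact ⟨_, hlin, htw, by simp, _, p, q, hS.insert_edges huv (hf.2 _ huv) hx
      (Or.inr ⟨rfl, rfl, rfl, rfl, rfl⟩)⟩

/-- Every outerpath DAG admits a linear extension whose maximum twist size is
at most 4. -/
theorem outerpath_dag_twist_le_four (E : Finset (ℕ × ℕ))
    (hE : IsOuterpathDAG E) :
    ∃ f, LinExt E f ∧ TwistLE E f 4 := by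
  obtain ⟨⟨u, v⟩, h⟩ := hE
  obtain ⟨f, hf, ht, -⟩ := h.exists_layout
  exact ⟨f, hf, ht⟩
end
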